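/- arXiv:2101.10217 — 2 statements merged into one kernel-verified Lean document; each statement's English description precedes it below -/
import Mathlib

section
/- Let K be a field of characteristic two and let A = Q(3A)_2^2 be the algebra of quaternion type given by the stated quiver and relations. Then A is periodic of period 4 as a bimodule: there is an exact sequence of A-A-bimodules 0 → A → P_3 → P_2 → P_1 → P_0 → A → 0 in which each P_i is a projective A-A-bimodule, and no such exact sequence of shorter positive length exists. -/
universe u

/-- The generators of the quiver of the algebra `Q(3A)₂²`: three vertex idempotents
`v1, v2, v3` and four arrows `ab : 1 → 2`, `ay : 2 → 1`, `ad : 2 → 3`, `an : 3 → 2`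
(named `b`, `y`, `d`, `n` in the informal description). -/
inductive QGen : Type
  | v1 | v2 | v3 | ab | ay | ad | an

open QGen FreeAlgebra in
/-- The defining relations presenting the algebra of quaternion type `Q(3A)₂²` as a quotient
of the free algebra on the vertices and arrows of the quiver: the vertex idempotents are
pairwise orthogonal idempotents summing to `1`, the arrows have the prescribed sources and
targets, and the relations `byb = bdnybdn`, `yby = dnybdny`, `ndn = nybdnyb`,
`dnd = ybdnybd`, `bybd = 0`, `ndny = 0` hold (paths are composed from left to right). -/
inductive QuatRel (K : Type u) [CommRing K] : FreeAlgebra K QGen → FreeAlgebra K QGen → Prop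
  | idem1 : QuatRel K (ι K v1 * ι K v1) (ι K v1)
  | idem2 : QuatRel K (ι K v2 * ι K v2) (ι K v2)
  | idem3 : QuatRel K (ι K v3 * ι K v3) (ι K v3)
  | orth12 : QuatRel K (ι K v1 * ι K v2) 0
  | orth21 : QuatRel K (ι K v2 * ι K v1) 0
  | orth13 : QuatRel K (ι K v1 * ι K v3) 0
  | orth31 : QuatRel K (ι K v3 * ι K v1) 0
  | orth23 : QuatRel K (ι K v2 * ι K v3) 0
  | orth32 : QuatRel K (ι K v3 * ι K v2) 0
  | unit : QuatRel K (ι K v1 + ι K v2 + ι K v3) 1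
  | src_b : QuatRel K (ι K v1 * ι K ab) (ι K ab)
  | tgt_b : QuatRel K (ι K ab * ι K v2) (ι K ab)
  | src_y : QuatRel K (ι K v2 * ι K ay) (ι K ay)
  | tgt_y : QuatRel K (ι K ay * ι K v1) (ι K ay)
  | src_d : QuatRel K (ι K v2 * ι K ad) (ι K ad)
  | tgt_d : QuatRel K (ι K ad * ι K v3) (ι K ad)
  | src_n : QuatRel K (ι K v3 * ι K an) (ι K an)
  | tgt_n : QuatRel K (ι K an * ι K v2) (ι K an)
  | rel1 : QuatRel K (ι K ab * ι K ay * ι K ab)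
      (ι K ab * ι K ad * ι K an * ι K ay * ι K ab * ι K ad * ι K an)
  | rel2 : QuatRel K (ι K ay * ι K ab * ι K ay)
      (ι K ad * ι K an * ι K ay * ι K ab * ι K ad * ι K an * ι K ay)
  | rel3 : QuatRel K (ι K an * ι K ad * ι K an)
      (ι K an * ι K ay * ι K ab * ι K ad * ι K an * ι K ay * ι K ab)
  | rel4 : QuatRel K (ι K ad * ι K an * ι K ad)
      (ι K ay * ι K ab * ι K ad * ι K an * ι K ay * ι K ab * ι K ad)
  | rel5 : QuatRel K (ι K ab * ι K ay * ι K ab * ι K ad) 0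
  | rel6 : QuatRel K (ι K an * ι K ad * ι K an * ι K ay) 0

/-- The algebra of quaternion type `Q(3A)₂²` over `K`: the path algebra of the quiver
modulo the admissible ideal, presented by generators and relations. -/
abbrev QuatAlg (K : Type u) [CommRing K] : Type u := RingQuot (QuatRel K)

/-- The images of the vertex idempotents and arrows in the algebra `Q(3A)₂²`. -/
noncomputable def qgen (K : Type u) [CommRing K] (x : QGen) : QuatAlg K :=
  RingQuot.mkAlgHom K (QuatRel K) (FreeAlgebra.ι K x)

open TensorProduct

/-- The enveloping algebra `A ⊗_K Aᵐᵒᵖ` of `A = Q(3A)₂²`; `A`-`A`-bimodules are the same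
as modules over this algebra. -/
abbrev QuatEnv (K : Type u) [Field K] : Type u := QuatAlg K ⊗[K] (QuatAlg K)ᵐᵒᵖ

/-- `A` as a module over its enveloping algebra `A ⊗_K Aᵐᵒᵖ`, i.e. as the regular
`A`-`A`-bimodule. -/
noncomputable instance quatEnvModule (K : Type u) [Field K] :
    Module (QuatEnv K) (QuatAlg K) :=
  TensorProduct.Algebra.module

/-- `A` as an object of the category of `A`-`A`-bimodules. -/
noncomputable def quatBimod (K : Type u) [Field K] : ModuleCat.{u} (QuatEnv K) :=
  ModuleCat.of (QuatEnv K) (QuatAlg K)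

/-- There is an exact sequence of `A`-`A`-bimodules `0 → A → P₀ → A → 0` with `P₀` a
projective bimodule (a periodicity resolution of length `1`). -/
def HasBimodPeriodicRes1 (K : Type u) [Field K] : Prop :=
  ∃ (P0 : ModuleCat.{u} (QuatEnv K)) (ι : quatBimod K ⟶ P0) (ε : P0 ⟶ quatBimod K),
    Module.Projective (QuatEnv K) P0 ∧
    Function.Injective ι ∧ Function.Surjective ε ∧ Function.Exact ι ε

/-- There is an exact sequence of `A`-`A`-bimodules `0 → A → P₁ → P₀ → A → 0` with `P₀, P₁`
projective bimodules (a periodicity resolution of length `2`). -/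
def HasBimodPeriodicRes2 (K : Type u) [Field K] : Prop :=
  ∃ (P0 P1 : ModuleCat.{u} (QuatEnv K)) (ι : quatBimod K ⟶ P1) (d1 : P1 ⟶ P0)
    (ε : P0 ⟶ quatBimod K),
    Module.Projective (QuatEnv K) P0 ∧ Module.Projective (QuatEnv K) P1 ∧
    Function.Injective ι ∧ Function.Surjective ε ∧
    Function.Exact ι d1 ∧ Function.Exact d1 ε

/-- There is an exact sequence of `A`-`A`-bimodules `0 → A → P₂ → P₁ → P₀ → A → 0` with
`P₀, P₁, P₂` projective bimodules (a periodicity resolution of length `3`). -/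
def HasBimodPeriodicRes3 (K : Type u) [Field K] : Prop :=
  ∃ (P0 P1 P2 : ModuleCat.{u} (QuatEnv K)) (ι : quatBimod K ⟶ P2) (d2 : P2 ⟶ P1)
    (d1 : P1 ⟶ P0) (ε : P0 ⟶ quatBimod K),
    Module.Projective (QuatEnv K) P0 ∧ Module.Projective (QuatEnv K) P1 ∧
    Module.Projective (QuatEnv K) P2 ∧
    Function.Injective ι ∧ Function.Surjective ε ∧
    Function.Exact ι d2 ∧ Function.Exact d2 d1 ∧ Function.Exact d1 ε

/-- There is an exact sequence of `A`-`A`-bimodules `0 → A → P₃ → P₂ → P₁ → P₀ → A → 0`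
with `P₀, P₁, P₂, P₃` projective bimodules (a periodicity resolution of length `4`). -/
def HasBimodPeriodicRes4 (K : Type u) [Field K] : Prop :=
  ∃ (P0 P1 P2 P3 : ModuleCat.{u} (QuatEnv K)) (ι : quatBimod K ⟶ P3) (d3 : P3 ⟶ P2)
    (d2 : P2 ⟶ P1) (d1 : P1 ⟶ P0) (ε : P0 ⟶ quatBimod K),
    Module.Projective (QuatEnv K) P0 ∧ Module.Projective (QuatEnv K) P1 ∧
    Module.Projective (QuatEnv K) P2 ∧ Module.Projective (QuatEnv K) P3 ∧
    Function.Injective ι ∧ Function.Surjective ε ∧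
    Function.Exact ι d3 ∧ Function.Exact d3 d2 ∧ Function.Exact d2 d1 ∧ Function.Exact d1 ε

namespace QuatAlg

open QGen TensorProduct

/-! ### A multiplicative basis of the algebra -/

/-- The paths forming a basis of the algebra, in the order in which they are numbered
from `1` to `36`. -/
def pathWords : List (List QGen) :=
  [[v1], [ab], [ab, ad],
   [ab, ad, an], [ab, ad, an, ay], [ab, ad, an, ay, ab],
   [ab, ad, an, ay, ab, ad], [ab, ad, an, ay, ab, ad, an], [ab, ad, an, ay, ab, ad, an, ay],
   [ab, ay], [v2], [ay],
   [ay, ab], [ay, ab, ad], [ay, ab, ad, an],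
   [ay, ab, ad, an, ay], [ay, ab, ad, an, ay, ab], [ay, ab, ad, an, ay, ab, ad],
   [ay, ab, ad, an, ay, ab, ad, an], [ad], [ad, an],
   [ad, an, ay], [ad, an, ay, ab], [ad, an, ay, ab, ad],
   [ad, an, ay, ab, ad, an], [ad, an, ay, ab, ad, an, ay], [v3],
   [an], [an, ay], [an, ay, ab],
   [an, ay, ab, ad], [an, ay, ab, ad, an], [an, ay, ab, ad, an, ay],
   [an, ay, ab, ad, an, ay, ab], [an, ay, ab, ad, an, ay, ab, ad], [an, ad]]

/-- The path with number `i`, if there is one. -/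
def pathWord : ℕ → Option (List QGen)
  | 0 => none
  | n + 1 => pathWords[n]?

/-- The table of the products of a path with a generator; the number `0` stands for the
zero element of the algebra. -/
def stepTable : QGen → List ℕ
  | v1 =>
      [0, 1, 0, 0, 0, 5, 0, 0, 0, 9, 10, 0, 12, 0, 0, 0, 16, 0, 0, 0, 0, 0, 22, 0, 0, 0, 26,
       0, 0, 29, 0, 0, 0, 33, 0, 0, 0]
  | v2 =>
      [0, 0, 2, 0, 4, 0, 6, 0, 8, 0, 0, 11, 0, 13, 0, 15, 0, 17, 0, 19, 0, 21, 0, 23, 0, 25,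
       0, 0, 28, 0, 30, 0, 32, 0, 34, 0, 0]
  | v3 =>
      [0, 0, 0, 3, 0, 0, 0, 7, 0, 0, 0, 0, 0, 0, 14, 0, 0, 0, 18, 0, 20, 0, 0, 0, 24, 0, 0,
       27, 0, 0, 0, 31, 0, 0, 0, 35, 36]
  | ab =>
      [0, 2, 0, 0, 0, 6, 0, 0, 0, 0, 8, 0, 13, 0, 0, 0, 17, 0, 0, 0, 0, 0, 23, 0, 0, 0, 19,
       0, 0, 30, 0, 0, 0, 34, 0, 0, 0]
  | ay =>
      [0, 0, 10, 0, 5, 0, 0, 0, 9, 0, 0, 12, 0, 26, 0, 16, 0, 0, 0, 0, 0, 22, 0, 0, 0, 26,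
       0, 0, 29, 0, 0, 0, 33, 0, 0, 0, 0]
  | ad =>
      [0, 0, 3, 0, 0, 0, 7, 0, 0, 0, 0, 20, 0, 14, 0, 0, 0, 18, 0, 0, 0, 18, 0, 24, 0, 0, 0,
       0, 36, 0, 31, 0, 0, 0, 35, 0, 0]
  | an =>
      [0, 0, 0, 4, 0, 0, 0, 8, 0, 0, 0, 0, 0, 0, 15, 0, 0, 0, 19, 0, 21, 0, 0, 0, 25, 0, 0,
       28, 0, 0, 0, 32, 0, 0, 0, 0, 34]

/-- The number of the product of the `i`-th path with a generator. -/
def step (g : QGen) (i : ℕ) : ℕ := (stepTable g).getD i 0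

/-- The number of the product of the `i`-th path with a word in the generators. -/
def stepWord (i : ℕ) (w : List QGen) : ℕ := w.foldl (fun k g => step g k) i

/-- The number of the product of the `i`-th and the `j`-th path. -/
def mulIdx (i j : ℕ) : ℕ := (pathWord j).elim 0 (stepWord i)

lemma step_eq_zero (g : QGen) {i : ℕ} (hi : 37 ≤ i) : step g i = 0 := by
  have : (stepTable g).length = 37 := by cases g <;> rfl
  simp [step, List.getElem?_eq_none (this ▸ hi)]

section Relations

variable (K : Type u) [CommRing K]

lemma mk_rel {x y : FreeAlgebra K QGen} (h : QuatRel K x y) :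
    RingQuot.mkAlgHom K (QuatRel K) x = RingQuot.mkAlgHom K (QuatRel K) y :=
  RingQuot.mkAlgHom_rel K h

lemma idem1 : qgen K v1 * qgen K v1 = qgen K v1 := by simpa [qgen] using mk_rel K .idem1
lemma idem2 : qgen K v2 * qgen K v2 = qgen K v2 := by simpa [qgen] using mk_rel K .idem2
lemma idem3 : qgen K v3 * qgen K v3 = qgen K v3 := by simpa [qgen] using mk_rel K .idem3
lemma orth12 : qgen K v1 * qgen K v2 = 0 := by simpa [qgen] using mk_rel K .orth12
lemma orth21 : qgen K v2 * qgen K v1 = 0 := by simpa [qgen] using mk_rel K .orth21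
lemma orth13 : qgen K v1 * qgen K v3 = 0 := by simpa [qgen] using mk_rel K .orth13
lemma orth31 : qgen K v3 * qgen K v1 = 0 := by simpa [qgen] using mk_rel K .orth31
lemma orth23 : qgen K v2 * qgen K v3 = 0 := by simpa [qgen] using mk_rel K .orth23
lemma orth32 : qgen K v3 * qgen K v2 = 0 := by simpa [qgen] using mk_rel K .orth32
lemma sum_idem : qgen K v1 + qgen K v2 + qgen K v3 = 1 := by
  simpa [qgen] using mk_rel K .unit
lemma src_b : qgen K v1 * qgen K ab = qgen K ab := by simpa [qgen] using mk_rel K .src_b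
lemma tgt_b : qgen K ab * qgen K v2 = qgen K ab := by simpa [qgen] using mk_rel K .tgt_b
lemma src_y : qgen K v2 * qgen K ay = qgen K ay := by simpa [qgen] using mk_rel K .src_y
lemma tgt_y : qgen K ay * qgen K v1 = qgen K ay := by simpa [qgen] using mk_rel K .tgt_y
lemma src_d : qgen K v2 * qgen K ad = qgen K ad := by simpa [qgen] using mk_rel K .src_d
lemma tgt_d : qgen K ad * qgen K v3 = qgen K ad := by simpa [qgen] using mk_rel K .tgt_d
lemma src_n : qgen K v3 * qgen K an = qgen K an := by simpa [qgen] using mk_rel K .src_n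
lemma tgt_n : qgen K an * qgen K v2 = qgen K an := by simpa [qgen] using mk_rel K .tgt_n

/-- The vertices of the quiver. -/
def vertex : Fin 3 → QGen := ![v1, v2, v3]

/-- The starting vertex of a generator. -/
def source : QGen → Fin 3
  | v1 => 0 | v2 => 1 | v3 => 2 | ab => 0 | ay => 1 | ad => 1 | an => 2

/-- The final vertex of a generator. -/
def target : QGen → Fin 3
  | v1 => 0 | v2 => 1 | v3 => 2 | ab => 1 | ay => 0 | ad => 2 | an => 1

lemma source_mul (g : QGen) : qgen K (vertex (source g)) * qgen K g = qgen K g := by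
  cases g <;>
    simp [source, vertex, idem1, idem2, idem3, src_b, src_y, src_d, src_n]

lemma mul_target (g : QGen) : qgen K g * qgen K (vertex (target g)) = qgen K g := by
  cases g <;>
    simp [target, vertex, idem1, idem2, idem3, tgt_b, tgt_y, tgt_d, tgt_n]

lemma vertex_orthogonal {i j : Fin 3} (hij : i ≠ j) :
    qgen K (vertex i) * qgen K (vertex j) = 0 := by
  fin_cases i <;> fin_cases j <;>
    simp_all [vertex, orth12, orth21, orth13, orth31, orth23, orth32]

lemma mul_eq_zero_of_ne {g h : QGen} (hgh : target g ≠ source h) :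
    qgen K g * qgen K h = 0 := by
  rw [← mul_target K g, ← source_mul K h, mul_assoc,
    ← mul_assoc (qgen K (vertex (target g))), vertex_orthogonal K hgh, zero_mul, mul_zero]

local notation "b" => qgen K ab
local notation "y" => qgen K ay
local notation "d" => qgen K ad
local notation "n" => qgen K an

lemma byb : b * (y * b) = b * (d * (n * (y * (b * (d * n))))) := by
  simpa [qgen, mul_assoc] using mk_rel K .rel1
lemma yby : y * (b * y) = d * (n * (y * (b * (d * (n * y))))) := by
  simpa [qgen, mul_assoc] using mk_rel K .rel2
lemma ndn : n * (d * n) = n * (y * (b * (d * (n * (y * b))))) := by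
  simpa [qgen, mul_assoc] using mk_rel K .rel3
lemma dnd : d * (n * d) = y * (b * (d * (n * (y * (b * d))))) := by
  simpa [qgen, mul_assoc] using mk_rel K .rel4
lemma bybd : b * (y * (b * d)) = 0 := by
  simpa [qgen, mul_assoc] using mk_rel K .rel5
lemma ndny : n * (d * (n * y)) = 0 := by
  simpa [qgen, mul_assoc] using mk_rel K .rel6

lemma bdnd : b * (d * (n * d)) = 0 := by
  have h := congrArg (fun x => x * (n * (y * (b * d)))) (bybd K)
  simp only [mul_assoc, zero_mul] at h
  rw [dnd, h]

lemma nyby : n * (y * (b * y)) = 0 := by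
  have h := congrArg (fun x => x * (b * (d * (n * y)))) (ndny K)
  simp only [mul_assoc, zero_mul] at h
  rw [yby, h]

lemma bdnybdnyb : b * (d * (n * (y * (b * (d * (n * (y * b))))))) = 0 := by
  have h := congrArg (fun x => x * (y * b)) (byb K)
  have h' := congrArg (fun x => x * (n * (y * (b * (d * n))))) (bybd K)
  simp only [mul_assoc, zero_mul] at h h'
  rw [← h, byb, h']

lemma nybdnybdn : n * (y * (b * (d * (n * (y * (b * (d * n))))))) = 0 := by
  have h := congrArg (fun x => x * (d * n)) (ndn K)
  have h' := congrArg (fun x => x * (b * (d * (n * (y * b))))) (ndny K)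
  simp only [mul_assoc, zero_mul] at h h'
  rw [← h, ndn, h']

lemma dnybdnyb : d * (n * (y * (b * (d * (n * (y * b)))))) =
    y * (b * (d * (n * (y * (b * (d * n)))))) := by
  have h := congrArg (fun x => x * b) (yby K)
  simp only [mul_assoc, byb] at h
  exact h.symm

lemma ybdnybdny : y * (b * (d * (n * (y * (b * (d * (n * y))))))) = 0 := by
  have h := congrArg (fun x => x * y) (dnybdnyb K)
  simp only [mul_assoc] at h
  rw [← h, nyby]
  simp

end Relations

section Basis

variable (K : Type u) [Field K]

/-- The element of the algebra given by a word in the generators. -/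
noncomputable def wordElt (w : List QGen) : QuatAlg K := (w.map (qgen K)).prod

/-- The element of the algebra given by the path with number `i`, and zero if there is none. -/
noncomputable def pathElt (i : ℕ) : QuatAlg K := (pathWord i).elim 0 (wordElt K)

lemma pathElt_of_le {i : ℕ} (hi : 37 ≤ i) : pathElt K i = 0 := by
  obtain ⟨i, rfl⟩ : ∃ k, i = k + 1 := ⟨i - 1, by lia⟩
  have : pathWords.length = 36 := rfl
  have : pathWords[i]? = none := List.getElem?_eq_none (by lia)
  simp [pathElt, pathWord, this]

@[simp] lemma pathElt_zero : pathElt K 0 = 0 := rfl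

lemma pathElt_mul_of_append {i : ℕ} {g : QGen} {w : List QGen} (hi : pathWord i = some w)
    (hg : pathWord (step g i) = some (w ++ [g])) :
    pathElt K i * qgen K g = pathElt K (step g i) := by
  simp [pathElt, hi, hg, wordElt]

lemma wordElt_mul_of_ne {g l : QGen} {w : List QGen} (hl : w.getLast? = some l)
    (hg : target l ≠ source g) : wordElt K w * qgen K g = 0 := by
  obtain ⟨w, rfl⟩ := List.getLast?_eq_some_iff.1 hl
  simp [wordElt, mul_assoc, mul_eq_zero_of_ne K hg]

lemma wordElt_mul_target {l : QGen} {w : List QGen} (hl : w.getLast? = some l) :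
    wordElt K w * qgen K (vertex (target l)) = wordElt K w := by
  obtain ⟨w, rfl⟩ := List.getLast?_eq_some_iff.1 hl
  simp [wordElt, mul_assoc, mul_target K]

lemma pathElt_mul_of_ne {i : ℕ} {g l : QGen} {w : List QGen} (hi : pathWord i = some w)
    (hl : w.getLast? = some l) (hg : target l ≠ source g) (h : step g i = 0) :
    pathElt K i * qgen K g = pathElt K (step g i) := by
  rw [h, pathElt_zero, pathElt, hi]
  exact wordElt_mul_of_ne K hl hg

lemma pathElt_mul_of_eq {i : ℕ} {g l : QGen} {w : List QGen} (hi : pathWord i = some w)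
    (hl : w.getLast? = some l) (hg : g = vertex (target l)) (h : step g i = i) :
    pathElt K i * qgen K g = pathElt K (step g i) := by
  rw [h, pathElt, hi, hg]
  exact wordElt_mul_target K hl

lemma pathElt_mul_qgen (i : ℕ) (g : QGen) :
    pathElt K i * qgen K g = pathElt K (step g i) := by
  rcases le_or_gt 37 i with hi | hi
  · simp [pathElt_of_le K hi, step_eq_zero g hi]
  · cases g <;> interval_cases i <;>
    first
    | exact zero_mul _
    | exact pathElt_mul_of_append K rfl rfl
    | exact pathElt_mul_of_eq K rfl rfl rfl rfl
    | exact pathElt_mul_of_ne K rfl rfl (by decide) rfl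
    | (simp [pathElt, pathWord, pathWords, wordElt, step, stepTable, mul_assoc,
        src_b, src_y, src_d, src_n, bdnd, nyby, bdnybdnyb, nybdnybdn, ybdnybdny]; done)
    | (simp [pathElt, pathWord, pathWords, wordElt, step, stepTable, mul_assoc, byb,
        yby, ndn, dnd, dnybdnyb])

end Basis
end QuatAlg

namespace QuatAlg

open QGen TensorProduct

section

variable (K : Type u) [Field K]

lemma pathElt_mul_wordElt (i : ℕ) (w : List QGen) :
    pathElt K i * wordElt K w = pathElt K (stepWord i w) := by
  induction w generalizing i with
  | nil => simp [wordElt, stepWord]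
  | cons g w ih =>
    have := ih (step g i)
    rw [wordElt, List.map_cons, List.prod_cons, ← mul_assoc, pathElt_mul_qgen]
    exact this

lemma pathElt_mul_pathElt (i j : ℕ) :
    pathElt K i * pathElt K j = pathElt K (mulIdx i j) := by
  rw [mulIdx]
  cases h : pathWord j with
  | none =>
    have : pathElt K j = 0 := by simp [pathElt, h]
    simp [this]
  | some w =>
    have : pathElt K j = wordElt K w := by simp [pathElt, h]
    rw [this, pathElt_mul_wordElt]
    rfl

/-- The numbers of the trivial paths. -/
def trivPath : Fin 3 → ℕ := ![1, 11, 27]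

lemma pathElt_trivPath (i : Fin 3) : pathElt K (trivPath i) = qgen K (vertex i) := by
  fin_cases i <;> simp [trivPath, pathElt, pathWord, pathWords, wordElt, vertex]

lemma sum_trivPath : ∑ i, pathElt K (trivPath i) = 1 := by
  simp [Fin.sum_univ_three, pathElt_trivPath, vertex, sum_idem]

lemma adjoin_qgen : Algebra.adjoin K (Set.range (qgen K)) = ⊤ := by
  have h : Set.range (qgen K) =
      RingQuot.mkAlgHom K (QuatRel K) '' Set.range (FreeAlgebra.ι K) := by
    rw [← Set.range_comp]; rfl
  rw [h, ← AlgHom.map_adjoin, FreeAlgebra.adjoin_range_ι, Algebra.map_top,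
    AlgHom.range_eq_top]
  exact RingQuot.mkAlgHom_surjective K (QuatRel K)

lemma span_pathElt : Submodule.span K (Set.range (pathElt K)) = ⊤ := by
  set S := Submodule.span K (Set.range (pathElt K))
  have key : ∀ a : QuatAlg K, ∀ x ∈ S, x * a ∈ S := by
    intro a
    have ha : a ∈ Algebra.adjoin K (Set.range (qgen K)) := by
      rw [adjoin_qgen]; trivial
    induction ha using Algebra.adjoin_induction with
    | mem a ha =>
      obtain ⟨g, rfl⟩ := ha
      intro x hx
      induction hx using Submodule.span_induction with
      | mem x hx =>
        obtain ⟨i, rfl⟩ := hx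
        rw [pathElt_mul_qgen]
        exact Submodule.subset_span ⟨_, rfl⟩
      | zero => simp
      | add x y _ _ hx hy => rw [add_mul]; exact S.add_mem hx hy
      | smul c x _ hx => rw [smul_mul_assoc]; exact S.smul_mem c hx
    | algebraMap c =>
      intro x hx
      rw [← Algebra.commutes, ← Algebra.smul_def]
      exact S.smul_mem c hx
    | add a b _ _ ha hb => intro x hx; rw [mul_add]; exact S.add_mem (ha x hx) (hb x hx)
    | mul a b _ _ ha hb => intro x hx; rw [← mul_assoc]; exact hb _ (ha x hx)
  have h1 : (1 : QuatAlg K) ∈ S := by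
    rw [← sum_trivPath]
    exact S.sum_mem fun i _ => Submodule.subset_span ⟨_, rfl⟩
  refine eq_top_iff.2 fun a _ => ?_
  simpa using key a 1 h1

/-! ### The dual of the regular representation -/

variable {K} in
/-- A function on the paths, extended by zero. -/
def extendZero (w : Fin 36 → K) : ℕ → K
  | 0 => 0
  | i + 1 => if h : i < 36 then w ⟨i, h⟩ else 0

/-- The action of a generator on the functions on the set of paths. -/
def pull (g : QGen) : Module.End K (Fin 36 → K) where
  toFun w i := extendZero w (step g (i + 1))
  map_add' v w := by
    ext i
    rcases h : step g (i + 1) with _ | k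
    · simp [extendZero, h]
    · by_cases hk : k < 36 <;> simp [extendZero, h, hk]
  map_smul' c w := by
    ext i
    rcases h : step g (i + 1) with _ | k
    · simp [extendZero, h]
    · by_cases hk : k < 36 <;> simp [extendZero, h, hk]

lemma step_zero (g : QGen) : step g 0 = 0 := by cases g <;> rfl

lemma extendZero_pull (g : QGen) (w : Fin 36 → K) (i : ℕ) :
    extendZero (pull K g w) i = extendZero w (step g i) := by
  rcases i with _ | i
  · rw [step_zero]; rfl
  · by_cases hi : i < 36
    · simp [extendZero, hi, pull]
    · rw [step_eq_zero g (by lia)]; simp [extendZero, hi]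

lemma extendZero_word (l : List QGen) (w : Fin 36 → K) (i : ℕ) :
    extendZero ((l.map (pull K)).prod w) i = extendZero w (stepWord i l) := by
  induction l generalizing i with
  | nil => simp [stepWord]
  | cons g l ih => simp [extendZero_pull, ih, stepWord]

lemma extendZero_succ (w : Fin 36 → K) (i : Fin 36) : extendZero w (i + 1) = w i := by
  simp [extendZero]

lemma prod_pull_apply (l : List QGen) (w : Fin 36 → K) (i : Fin 36) :
    (l.map (pull K)).prod w i = extendZero w (stepWord (i + 1) l) := by
  rw [← extendZero_word]
  exact (extendZero_succ K _ i).symm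

lemma prod_pull_eq {l l' : List QGen}
    (h : ∀ i : Fin 36, stepWord (i + 1) l = stepWord (i + 1) l') :
    (l.map (pull K)).prod = (l'.map (pull K)).prod := by
  refine LinearMap.ext fun w => funext fun i => ?_
  rw [prod_pull_apply, prod_pull_apply, h]

lemma prod_pull_eq_zero {l : List QGen} (h : ∀ i : Fin 36, stepWord (i + 1) l = 0) :
    (l.map (pull K)).prod = 0 := by
  refine LinearMap.ext fun w => funext fun i => ?_
  rw [prod_pull_apply, h]
  rfl

lemma sum_pull : pull K v1 + pull K v2 + pull K v3 = 1 := by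
  refine LinearMap.ext fun w => funext fun i => ?_
  fin_cases i <;> simp [pull, step, stepTable, extendZero]

/-- The algebra acts on the functions on the set of paths. -/
noncomputable def dualRep : QuatAlg K →ₐ[K] Module.End K (Fin 36 → K) :=
  RingQuot.liftAlgHom K ⟨FreeAlgebra.lift K (pull K), by
    intro x y hxy
    cases hxy
    case unit => simpa using sum_pull K
    case idem1 => simpa using prod_pull_eq K (l := [v1, v1]) (l' := [v1]) (by decide)
    case idem2 => simpa using prod_pull_eq K (l := [v2, v2]) (l' := [v2]) (by decide)
    case idem3 => simpa using prod_pull_eq K (l := [v3, v3]) (l' := [v3]) (by decide)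
    case orth12 => simpa using prod_pull_eq_zero K (l := [v1, v2]) (by decide)
    case orth21 => simpa using prod_pull_eq_zero K (l := [v2, v1]) (by decide)
    case orth13 => simpa using prod_pull_eq_zero K (l := [v1, v3]) (by decide)
    case orth31 => simpa using prod_pull_eq_zero K (l := [v3, v1]) (by decide)
    case orth23 => simpa using prod_pull_eq_zero K (l := [v2, v3]) (by decide)
    case orth32 => simpa using prod_pull_eq_zero K (l := [v3, v2]) (by decide)
    case src_b => simpa using prod_pull_eq K (l := [v1, ab]) (l' := [ab]) (by decide)
    case tgt_b => simpa using prod_pull_eq K (l := [ab, v2]) (l' := [ab]) (by decide)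
    case src_y => simpa using prod_pull_eq K (l := [v2, ay]) (l' := [ay]) (by decide)
    case tgt_y => simpa using prod_pull_eq K (l := [ay, v1]) (l' := [ay]) (by decide)
    case src_d => simpa using prod_pull_eq K (l := [v2, ad]) (l' := [ad]) (by decide)
    case tgt_d => simpa using prod_pull_eq K (l := [ad, v3]) (l' := [ad]) (by decide)
    case src_n => simpa using prod_pull_eq K (l := [v3, an]) (l' := [an]) (by decide)
    case tgt_n => simpa using prod_pull_eq K (l := [an, v2]) (l' := [an]) (by decide)
    case rel1 =>
      simpa [mul_assoc] using prod_pull_eq K (l := [ab, ay, ab])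
        (l' := [ab, ad, an, ay, ab, ad, an]) (by decide +kernel)
    case rel2 =>
      simpa [mul_assoc] using prod_pull_eq K (l := [ay, ab, ay])
        (l' := [ad, an, ay, ab, ad, an, ay]) (by decide +kernel)
    case rel3 =>
      simpa [mul_assoc] using prod_pull_eq K (l := [an, ad, an])
        (l' := [an, ay, ab, ad, an, ay, ab]) (by decide +kernel)
    case rel4 =>
      simpa [mul_assoc] using prod_pull_eq K (l := [ad, an, ad])
        (l' := [ay, ab, ad, an, ay, ab, ad]) (by decide +kernel)
    case rel5 =>
      simpa [mul_assoc] using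
        prod_pull_eq_zero K (l := [ab, ay, ab, ad]) (by decide +kernel)
    case rel6 =>
      simpa [mul_assoc] using
        prod_pull_eq_zero K (l := [an, ad, an, ay]) (by decide +kernel)⟩

lemma dualRep_qgen (g : QGen) : dualRep K (qgen K g) = pull K g := by
  simp [dualRep, qgen]

lemma dualRep_wordElt (l : List QGen) : dualRep K (wordElt K l) = (l.map (pull K)).prod := by
  simp [wordElt, map_list_prod, Function.comp_def, dualRep_qgen]

/-- The number of the initial vertex of a path. -/
def pathSource (i : Fin 36) : Fin 3 := if i.val < 10 then 0 else if i.val < 26 then 1 else 2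

lemma stepWord_trivPath (k : Fin 3) (i : Fin 36) :
    stepWord (trivPath k) pathWords[i] = if k = pathSource i then i.val + 1 else 0 := by
  revert k i
  decide +kernel

/-- The coordinates of an element of the algebra with respect to the paths. -/
noncomputable def coords : QuatAlg K →ₗ[K] Fin 36 → K :=
  LinearMap.pi fun j => ∑ k : Fin 3,
    (LinearMap.proj (R := K) (φ := fun _ : Fin 36 => K) (![0, 10, 26] k)).comp
      ((LinearMap.applyₗ (Pi.single j 1)).comp (dualRep K).toLinearMap)

lemma coords_pathElt (i : Fin 36) : coords K (pathElt K (i + 1)) = Pi.single i 1 := by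
  funext j
  have hw : pathElt K (i + 1) = wordElt K pathWords[i] := by
    have : pathWords[i.val]? = some pathWords[i] := List.getElem?_eq_getElem _
    simp [pathElt, pathWord, this]
  have hk : ∀ k : Fin 3, trivPath k = (![0, 10, 26] k : Fin 36).val + 1 := by decide
  have h (k : Fin 3) : dualRep K (pathElt K (i + 1)) (Pi.single j 1) (![0, 10, 26] k) =
      if k = pathSource i then (Pi.single i 1 : Fin 36 → K) j else 0 := by
    rw [hw, dualRep_wordElt, prod_pull_apply, ← hk, stepWord_trivPath]
    split_ifs
    · rw [extendZero_succ, Pi.single_apply, Pi.single_apply]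
      simp [eq_comm]
    · rfl
  simp [coords, h]

/-- The basis of the algebra formed by the paths. -/
noncomputable def pathBasis : Module.Basis (Fin 36) K (QuatAlg K) :=
  Module.Basis.mk (v := fun i : Fin 36 => pathElt K (i + 1))
    (by
      refine LinearIndependent.of_comp (coords K) ?_
      have : coords K ∘ (fun i : Fin 36 => pathElt K (i + 1)) = fun i => Pi.single i 1 :=
        funext (coords_pathElt K)
      rw [this]
      exact Pi.linearIndependent_single_one (Fin 36) K)
    (by
      rw [← span_pathElt, Submodule.span_le]
      rintro _ ⟨i, rfl⟩
      rcases i with _ | i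
      · simp
      · by_cases hi : i < 36
        · exact Submodule.subset_span ⟨⟨i, hi⟩, rfl⟩
        · simp [pathElt_of_le K (show 37 ≤ i + 1 by lia)])

@[simp] lemma pathBasis_apply (i : Fin 36) : pathBasis K i = pathElt K (i + 1) := by
  simp [pathBasis]

end

/-! ### Linear combinations of elementary tensors -/

/-- The triple `(j, a, c)` encodes the tensor product of the paths with numbers `a` and `c`
in the `j`-th component of a free bimodule of rank four. -/
abbrev Triple : Type := Fin 4 × ℕ × ℕ

/-- Any element of the list which does not satisfy `p` occurs an even number of times. -/
abbrev CancelsExcept {α : Type*} [DecidableEq α] (p : α → Prop) (l : List α) : Prop :=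
  ∀ t ∈ l, p t ∨ Even (l.count t)

/-- A triple encoding the zero element. -/
abbrev Triple.IsNull (t : Triple) : Prop := t.2.1 = 0 ∨ t.2.2 = 0

/-- The entry of the `j`-th row of a table for the path with number `a`. -/
def lookup {β : Type*} (tab : Fin 4 → List (ℕ × List β)) (j : Fin 4) (a : ℕ) : List β :=
  ((tab j).lookup a).getD []

/-- The keys in the rows of a table are numbers of paths. -/
abbrev IsTable {β : Type*} (tab : Fin 4 → List (ℕ × List β)) : Prop :=
  ∀ j, ∀ p ∈ tab j, 0 < p.1 ∧ p.1 < 37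

lemma lookup_eq_nil {β : Type*} {tab : Fin 4 → List (ℕ × List β)} (h : IsTable tab) (j : Fin 4)
    {a : ℕ} (ha : a = 0 ∨ 37 ≤ a) : lookup tab j a = [] := by
  have : (tab j).lookup a = none := by
    rw [List.lookup_eq_none_iff]
    intro p hp
    have := h j p hp
    rw [bne_iff_ne]
    lia
  rw [lookup, this, Option.getD_none]

/-- Multiplication of a list of triples by a path from the left. -/
def lmulTriples (a : ℕ) (l : List Triple) : List Triple :=
  l.map fun t => (t.1, mulIdx a t.2.1, t.2.2)

/-- Multiplication of a list of triples by a path from the right. -/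
def rmulTriples (c : ℕ) (l : List Triple) : List Triple :=
  l.map fun t => (t.1, t.2.1, mulIdx t.2.2 c)

/-- The effect on lists of triples of the bimodule homomorphism sending the generators to the
given elements. -/
def bimodTriples (D : Fin 4 → List Triple) (l : List Triple) : List Triple :=
  l.flatMap fun t => (D t.1).map fun s => (s.1, mulIdx t.2.1 s.2.1, mulIdx s.2.2 t.2.2)

/-- The effect on lists of triples of the homomorphism of right modules given by a table. -/
def rightTriples (tab : Fin 4 → List (ℕ × List Triple)) (l : List Triple) : List Triple :=
  l.flatMap fun t => (lookup tab t.1 t.2.1).map fun s => (s.1, s.2.1, mulIdx s.2.2 t.2.2)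

section

variable (K : Type u) [Field K]

/-- The free bimodule of rank four. -/
abbrev FreeBimod : Type u := Fin 4 →₀ QuatEnv K

/-- The elementary tensor encoded by a triple. -/
noncomputable def triple (t : Triple) : FreeBimod K :=
  Finsupp.single t.1 (pathElt K t.2.1 ⊗ₜ MulOpposite.op (pathElt K t.2.2))

/-- The sum of the elementary tensors in a list. -/
noncomputable def sumTriples (l : List Triple) : FreeBimod K := (l.map (triple K)).sum

/-- The sum of the paths with the given numbers. -/
noncomputable def sumPaths (l : List ℕ) : QuatAlg K := (l.map (pathElt K)).sum

lemma sumTriples_append (l l' : List Triple) :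
    sumTriples K (l ++ l') = sumTriples K l + sumTriples K l' := by
  simp [sumTriples]

lemma sumTriples_flatMap {α : Type*} (l : List α) (f : α → List Triple) :
    sumTriples K (l.flatMap f) = (l.map fun t => sumTriples K (f t)).sum := by
  induction l with
  | nil => simp [sumTriples]
  | cons t l ih => simp [sumTriples_append, ih]

lemma sum_map_eq_zero [CharP K 2] {α N : Type*} [DecidableEq α] [AddCommMonoid N] [Module K N]
    {p : α → Prop} {φ : α → N} (hφ : ∀ t, p t → φ t = 0) {l : List α}
    (hl : CancelsExcept p l) : (l.map φ).sum = 0 := by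
  rw [Finset.sum_list_map_count]
  refine Finset.sum_eq_zero fun t ht => ?_
  rcases hl t (List.mem_toFinset.1 ht) with h | ⟨m, hm⟩
  · rw [hφ t h, smul_zero]
  · rw [hm, ← two_mul, mul_smul, ← Nat.cast_smul_eq_nsmul K 2, Nat.cast_ofNat,
      CharTwo.two_eq_zero, zero_smul]

lemma triple_eq_zero {t : Triple} (ht : t.IsNull) : triple K t = 0 := by
  rcases ht with h | h <;> simp [triple, h]

lemma sumTriples_eq_zero [CharP K 2] {l : List Triple} (hl : CancelsExcept Triple.IsNull l) :
    sumTriples K l = 0 :=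
  sum_map_eq_zero K (fun _ h => triple_eq_zero K h) hl

lemma sumTriples_eq [CharP K 2] {l l' : List Triple}
    (hl : CancelsExcept Triple.IsNull (l ++ l')) : sumTriples K l = sumTriples K l' := by
  have h := sumTriples_eq_zero K hl
  rw [sumTriples_append] at h
  have h2 : sumTriples K l' + sumTriples K l' = 0 := by
    rw [← two_smul K, CharTwo.two_eq_zero, zero_smul]
  rw [← add_zero (sumTriples K l), ← h2, ← add_assoc, h, zero_add]

/-! ### Bimodule homomorphisms -/

lemma tmul_smul_triple (a c : ℕ) (t : Triple) :
    (pathElt K a ⊗ₜ[K] MulOpposite.op (pathElt K c)) • triple K t =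
      triple K (t.1, mulIdx a t.2.1, mulIdx t.2.2 c) := by
  simp [triple, ← MulOpposite.op_mul, pathElt_mul_pathElt]

lemma one_tmul_smul_triple (c : ℕ) (t : Triple) :
    ((1 : QuatAlg K) ⊗ₜ[K] MulOpposite.op (pathElt K c)) • triple K t =
      triple K (t.1, t.2.1, mulIdx t.2.2 c) := by
  simp [triple, ← MulOpposite.op_mul, pathElt_mul_pathElt]

lemma tmul_one_smul_triple (a : ℕ) (t : Triple) :
    (pathElt K a ⊗ₜ[K] (1 : (QuatAlg K)ᵐᵒᵖ)) • triple K t =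
      triple K (t.1, mulIdx a t.2.1, t.2.2) := by
  simp [triple, pathElt_mul_pathElt]

lemma tmul_smul_sumTriples (a c : ℕ) (l : List Triple) :
    (pathElt K a ⊗ₜ[K] MulOpposite.op (pathElt K c)) • sumTriples K l =
      sumTriples K (l.map fun s => (s.1, mulIdx a s.2.1, mulIdx s.2.2 c)) := by
  simp [sumTriples, List.smul_sum, Function.comp_def, tmul_smul_triple]

lemma one_tmul_smul_sumTriples (c : ℕ) (l : List Triple) :
    ((1 : QuatAlg K) ⊗ₜ[K] MulOpposite.op (pathElt K c)) • sumTriples K l =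
      sumTriples K (rmulTriples c l) := by
  simp [sumTriples, rmulTriples, List.smul_sum, Function.comp_def, one_tmul_smul_triple]

lemma tmul_one_smul_sumTriples (a : ℕ) (l : List Triple) :
    (pathElt K a ⊗ₜ[K] (1 : (QuatAlg K)ᵐᵒᵖ)) • sumTriples K l =
      sumTriples K (lmulTriples a l) := by
  simp [sumTriples, lmulTriples, List.smul_sum, Function.comp_def, tmul_one_smul_triple]

/-- The endomorphism of the free bimodule sending the generators to the given elements. -/
noncomputable def bimodMap (D : Fin 4 → List Triple) : FreeBimod K →ₗ[QuatEnv K] FreeBimod K :=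
  Finsupp.linearCombination (QuatEnv K) fun j => sumTriples K (D j)

lemma bimodMap_sumTriples (D : Fin 4 → List Triple) (l : List Triple) :
    bimodMap K D (sumTriples K l) = sumTriples K (bimodTriples D l) := by
  rw [bimodTriples, sumTriples_flatMap, sumTriples, map_list_sum, List.map_map]
  congr 2
  funext t
  simp [bimodMap, triple, tmul_smul_sumTriples]

lemma bimodMap_single (D : Fin 4 → List Triple) (j : Fin 4) :
    bimodMap K D (Finsupp.single j 1) = sumTriples K (D j) := by
  simp [bimodMap]

lemma bimodMap_comp_eq [CharP K 2] {D D' D'' : Fin 4 → List Triple}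
    (h : ∀ j, CancelsExcept Triple.IsNull (bimodTriples D (D' j) ++ D'' j)) :
    bimodMap K D ∘ₗ bimodMap K D' = bimodMap K D'' := by
  refine Finsupp.lhom_ext' fun j => LinearMap.ext_ring ?_
  simp [bimodMap_single, bimodMap_sumTriples, sumTriples_eq K (h j)]

/-! ### Homomorphisms of right modules -/

section RightLinear

variable {K} {M N L : Type*} [AddCommMonoid M] [Module K M] [Module (QuatEnv K) M]
  [AddCommMonoid N] [Module K N] [Module (QuatEnv K) N]
  [AddCommMonoid L] [Module K L] [Module (QuatEnv K) L]

/-- Compatibility with the action of the algebra from the right. -/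
def IsRightLinear (G : M →ₗ[K] N) : Prop :=
  ∀ (y : (QuatAlg K)ᵐᵒᵖ) (x : M),
    G (((1 : QuatAlg K) ⊗ₜ[K] y) • x) = ((1 : QuatAlg K) ⊗ₜ[K] y) • G x

lemma IsRightLinear.comp {H : N →ₗ[K] L} {G : M →ₗ[K] N} (hH : IsRightLinear H)
    (hG : IsRightLinear G) : IsRightLinear (H ∘ₗ G) :=
  fun y x => by simp [hG y x, hH y]

lemma IsRightLinear.add {H G : M →ₗ[K] N} (hH : IsRightLinear H)
    (hG : IsRightLinear G) : IsRightLinear (H + G) :=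
  fun y x => by simp [hG y x, hH y]

lemma isRightLinear_restrictScalars [IsScalarTower K (QuatEnv K) M]
    [IsScalarTower K (QuatEnv K) N] (G : M →ₗ[QuatEnv K] N) :
    IsRightLinear (G.restrictScalars K) :=
  fun y x => by simp

/-- A homomorphism of right modules vanishing on sufficiently many elementary tensors is zero. -/
lemma IsRightLinear.eq_zero {G : FreeBimod K →ₗ[K] N} (hG : IsRightLinear G)
    (h : ∀ (j : Fin 4) (a : Fin 36) (k : Fin 3), G (triple K (j, a + 1, trivPath k)) = 0) :
    G = 0 := by
  refine Finsupp.lhom_ext' fun j => TensorProduct.ext' fun x y => ?_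
  suffices H : ∀ x : QuatAlg K, G (Finsupp.single j (x ⊗ₜ 1)) = 0 by
    have := hG y (Finsupp.single j (x ⊗ₜ 1))
    rw [H, smul_zero] at this
    simpa using this
  intro x
  have hlin : G ∘ₗ Finsupp.lsingle j ∘ₗ (TensorProduct.mk K _ _).flip 1 = 0 := by
    refine (pathBasis K).ext fun a => ?_
    have h1 : (1 : (QuatAlg K)ᵐᵒᵖ) = ∑ k, MulOpposite.op (pathElt K (trivPath k)) := by
      rw [← MulOpposite.op_one, ← sum_trivPath, Finset.op_sum]
    have h2 := fun k => h j a k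
    simp only [triple] at h2
    simp [h1, h2]
  exact LinearMap.congr_fun hlin x

end RightLinear

end

section

variable (K : Type u) [Field K]

section RightMap

variable {N : Type u} [AddCommMonoid N] [Module K N] [Module (QuatEnv K) N]
  [IsScalarTower K (QuatEnv K) N]

/-- The homomorphism of right modules sending the tensor product of the `i`-th path with `1`
in the `j`-th component to `ν j i`. -/
noncomputable def rightMap (ν : Fin 4 → ℕ → N) : FreeBimod K →ₗ[K] N :=
  Finsupp.lsum K fun j => TensorProduct.lift <| (pathBasis K).constr K fun i =>
    (LinearMap.toSpanSingleton (QuatEnv K) N (ν j (i + 1))).restrictScalars K ∘ₗ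
      TensorProduct.mk K (QuatAlg K) (QuatAlg K)ᵐᵒᵖ 1

lemma rightMap_single_basis (ν : Fin 4 → ℕ → N) (j : Fin 4) (i : Fin 36) (y : (QuatAlg K)ᵐᵒᵖ) :
    rightMap K ν (Finsupp.single j (pathElt K (i + 1) ⊗ₜ y)) =
      ((1 : QuatAlg K) ⊗ₜ[K] y) • ν j (i + 1) := by
  rw [← pathBasis_apply]
  simp only [rightMap, Finsupp.lsum_single, TensorProduct.lift.tmul, Module.Basis.constr_basis]
  simp

lemma rightMap_triple {ν : Fin 4 → ℕ → N} (hν : ∀ j a, a = 0 ∨ 37 ≤ a → ν j a = 0)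
    (t : Triple) : rightMap K ν (triple K t) =
      ((1 : QuatAlg K) ⊗ₜ[K] MulOpposite.op (pathElt K t.2.2)) • ν t.1 t.2.1 := by
  obtain ⟨j, a, c⟩ := t
  by_cases ha : a = 0 ∨ 37 ≤ a
  · have : pathElt K a = 0 := by
      rcases ha with rfl | ha
      · rfl
      · exact pathElt_of_le K ha
    simp [triple, this, hν j a ha]
  · obtain ⟨i, rfl⟩ : ∃ i : Fin 36, a = i + 1 := ⟨⟨a - 1, by lia⟩, by simp; lia⟩
    exact rightMap_single_basis K ν j i _

lemma isRightLinear_rightMap (ν : Fin 4 → ℕ → N) : IsRightLinear (rightMap K ν) := by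
  intro y x
  induction x using Finsupp.induction_linear with
  | zero => simp
  | add x x' hx hx' => simp only [smul_add, map_add, hx, hx']
  | single j e =>
    induction e using TensorProduct.induction_on with
    | zero => simp
    | add e e' he he' => simp only [Finsupp.single_add, smul_add, map_add, he, he']
    | tmul a c =>
      have h : a ∈ Submodule.span K (Set.range (pathBasis K)) := by
        rw [(pathBasis K).span_eq]; trivial
      induction h using Submodule.span_induction with
      | zero => simp
      | add a a' _ _ ha ha' =>
        simp only [TensorProduct.add_tmul, Finsupp.single_add, smul_add, map_add, ha, ha']
      | smul r a _ ha =>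
        rw [← TensorProduct.smul_tmul', ← Finsupp.smul_single]
        rw [smul_comm, map_smul, ha, map_smul, smul_comm]
      | mem a ha =>
        obtain ⟨i, rfl⟩ := ha
        rw [pathBasis_apply, rightMap_single_basis, Finsupp.smul_single, smul_eq_mul,
          Algebra.TensorProduct.tmul_mul_tmul, one_mul, rightMap_single_basis, smul_smul,
          Algebra.TensorProduct.tmul_mul_tmul, one_mul]

end RightMap

/-- The homomorphism of right modules given by a table. -/
noncomputable def tableMap (tab : Fin 4 → List (ℕ × List Triple)) :
    FreeBimod K →ₗ[K] FreeBimod K :=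
  rightMap K fun j a => sumTriples K (lookup tab j a)

lemma tableMap_sumTriples {tab : Fin 4 → List (ℕ × List Triple)} (h : IsTable tab)
    (l : List Triple) :
    tableMap K tab (sumTriples K l) = sumTriples K (rightTriples tab l) := by
  rw [rightTriples, sumTriples_flatMap, sumTriples, map_list_sum, List.map_map]
  congr 2
  funext t
  rw [Function.comp_apply, tableMap, rightMap_triple, one_tmul_smul_sumTriples, rmulTriples]
  intro j a ha
  rw [lookup_eq_nil h j ha]
  rfl

lemma sumTriples_singleton (t : Triple) : sumTriples K [t] = triple K t := by
  simp [sumTriples]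

lemma homotopy_eq [CharP K 2] {D D' P : Fin 4 → List Triple}
    {tab tab' : Fin 4 → List (ℕ × List Triple)} (h : IsTable tab) (h' : IsTable tab')
    (H : ∀ (j : Fin 4) (a : Fin 36) (k : Fin 3),
      CancelsExcept Triple.IsNull
        (bimodTriples D (rightTriples tab [(j, a + 1, trivPath k)]) ++
          rightTriples tab' (bimodTriples D' [(j, a + 1, trivPath k)]) ++
          bimodTriples P [(j, a + 1, trivPath k)])) (x : FreeBimod K) :
    bimodMap K D (tableMap K tab x) + tableMap K tab' (bimodMap K D' x) + bimodMap K P x = 0 := by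
  have hR (D) : IsRightLinear ((bimodMap K D).restrictScalars K) :=
    isRightLinear_restrictScalars _
  have hT (tab) : IsRightLinear (tableMap K tab) := isRightLinear_rightMap K _
  have := (((hR D).comp (hT tab)).add ((hT tab').comp (hR D'))).add (hR P)
  refine LinearMap.congr_fun (this.eq_zero fun j a k => ?_) x
  rw [← sumTriples_singleton]
  simp only [LinearMap.add_apply, LinearMap.comp_apply, LinearMap.coe_restrictScalars]
  rw [tableMap_sumTriples K h, bimodMap_sumTriples, bimodMap_sumTriples,
    tableMap_sumTriples K h', bimodMap_sumTriples, ← sumTriples_append, ← sumTriples_append]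
  exact sumTriples_eq_zero K (H j a k)

end

/-! ### The minimal bimodule resolution -/

/-- The generators of the terms of degree `0` and `3`, indexed by the vertices. -/
def vertexGen : Fin 4 → List Triple := ![[(0, 1, 1)], [(1, 11, 11)], [(2, 27, 27)], []]

/-- The generators of the terms of degree `1` and `2`, indexed by the arrows. -/
def arrowGen : Fin 4 → List Triple := ![[(0, 1, 11)], [(1, 11, 1)], [(2, 11, 27)], [(3, 27, 11)]]

/-- The differential of degree `1`. -/
def diff1 : Fin 4 → List Triple :=
  ![[(0, 1, 2), (1, 2, 11)],
    [(0, 12, 1), (1, 11, 12)],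
    [(1, 11, 20), (2, 20, 27)],
    [(1, 28, 11), (2, 27, 28)]]

/-- The differential of degree `2`. -/
def diff2 : Fin 4 → List Triple :=
  ![[(0, 1, 13), (0, 1, 25), (0, 5, 21), (0, 10, 11), (1, 2, 2), (1, 4, 4), (2, 2, 32),
     (2, 6, 28), (3, 3, 15), (3, 7, 11)],
    [(0, 12, 12), (0, 22, 22), (1, 11, 10), (1, 13, 1), (1, 21, 5), (1, 25, 1), (2, 11, 33),
     (2, 23, 29), (3, 20, 16), (3, 24, 12)],
    [(0, 12, 24), (0, 16, 20), (1, 11, 7), (1, 15, 3), (2, 11, 36), (2, 13, 31), (2, 17, 27),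
     (2, 21, 27), (3, 14, 14), (3, 20, 20)],
    [(0, 29, 23), (0, 33, 11), (1, 28, 6), (1, 32, 2), (2, 28, 28), (2, 30, 30), (3, 27, 17),
     (3, 27, 21), (3, 31, 13), (3, 36, 11)]]

/-- The differential of degree `3`. -/
def diff3 : Fin 4 → List Triple :=
  ![[(0, 1, 12), (1, 2, 1)],
    [(0, 12, 11), (1, 11, 2), (2, 11, 28), (3, 20, 11)],
    [(2, 28, 27), (3, 27, 20)],
    []]

/-- The Casimir element generating the kernel of the differential of degree `3`. -/
def casimir : List Triple :=
  [(0, 1, 9), (0, 5, 5), (0, 9, 1), (0, 10, 10), (0, 12, 8), (0, 16, 4), (0, 22, 6), (0, 26, 2),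
   (0, 29, 7), (0, 33, 3), (1, 2, 26), (1, 4, 16), (1, 6, 22), (1, 8, 12), (1, 11, 19),
   (1, 13, 25), (1, 15, 15), (1, 17, 17), (1, 17, 21), (1, 19, 11), (1, 21, 17), (1, 23, 23),
   (1, 25, 13), (1, 25, 25), (1, 28, 18), (1, 30, 24), (1, 32, 14), (1, 34, 20), (2, 3, 33),
   (2, 7, 29), (2, 14, 32), (2, 18, 28), (2, 20, 34), (2, 24, 30), (2, 27, 35), (2, 31, 31),
   (2, 35, 27), (2, 36, 36)]

/-- The numbers of the trivial paths at the vertices. -/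
def vertexPath : Fin 4 → ℕ := ![1, 11, 27, 0]

/-- The element mapped to `1` by the augmentation. -/
def unitTriples : List Triple := [(0, 1, 1), (1, 11, 11), (2, 27, 27)]

/-- The contracting homotopy in degree `0`. -/
def homotopy0 : Fin 4 → List (ℕ × List Triple) :=
  ![[(5, [(0, 1, 22), (1, 4, 1), (2, 2, 29), (3, 3, 12)]), (9, [(0, 1, 26), (0, 5, 22),
     (1, 4, 5), (1, 8, 1), (2, 2, 33), (2, 6, 29), (3, 3, 16), (3, 7, 12)]), (10, [(0, 1, 12),
     (1, 2, 1)]), (12, [(1, 11, 1)]), (16, [(0, 12, 22), (1, 11, 5), (1, 15, 1), (2, 13, 29),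
     (3, 14, 12)]), (22, [(1, 21, 1), (2, 11, 29), (3, 20, 12)]), (26, [(0, 22, 22), (1, 21, 5),
     (1, 25, 1), (2, 11, 33), (2, 23, 29), (3, 20, 16), (3, 24, 12)]), (29, [(1, 28, 1),
     (3, 27, 12)]), (33, [(0, 29, 22), (1, 28, 5), (1, 32, 1), (2, 30, 29), (3, 27, 16),
     (3, 31, 12)])],
    [(2, [(0, 1, 11)]), (4, [(0, 1, 21), (2, 2, 28), (3, 3, 11)]), (6, [(0, 1, 23), (0, 5, 11),
     (1, 4, 2), (2, 2, 30), (3, 3, 13)]), (8, [(0, 1, 25), (0, 5, 21), (1, 4, 4), (2, 2, 32),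
     (2, 6, 28), (3, 3, 15), (3, 7, 11)]), (13, [(0, 12, 11), (1, 11, 2)]), (15, [(0, 12, 21),
     (1, 11, 4), (2, 13, 28), (3, 14, 11)]), (17, [(0, 12, 23), (0, 16, 11), (1, 11, 6),
     (1, 15, 2), (2, 13, 30), (3, 14, 13)]), (19, [(0, 12, 25), (0, 16, 21), (1, 11, 8),
     (1, 15, 4), (2, 13, 32), (2, 17, 28), (3, 14, 15), (3, 18, 11)]), (21, [(2, 11, 28),
     (3, 20, 11)]), (23, [(0, 22, 11), (1, 21, 2), (2, 11, 30), (3, 20, 13)]), (25, [(0, 22, 21),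
     (1, 21, 4), (2, 11, 32), (2, 23, 28), (3, 20, 15), (3, 24, 11)]), (28, [(3, 27, 11)]),
     (30, [(0, 29, 11), (1, 28, 2), (3, 27, 13)]), (32, [(0, 29, 21), (1, 28, 4), (2, 30, 28),
     (3, 27, 15), (3, 31, 11)]), (34, [(0, 29, 23), (0, 33, 11), (1, 28, 6), (1, 32, 2),
     (2, 30, 30), (3, 27, 17), (3, 31, 13)])],
    [(3, [(0, 1, 20), (2, 2, 27)]), (7, [(0, 1, 24), (0, 5, 20), (1, 4, 3), (2, 2, 31),
     (2, 6, 27), (3, 3, 14)]), (14, [(0, 12, 20), (1, 11, 3), (2, 13, 27)]), (18, [(0, 12, 24),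
     (0, 16, 20), (1, 11, 7), (1, 15, 3), (2, 13, 31), (2, 17, 27), (3, 14, 14)]),
     (20, [(2, 11, 27)]), (24, [(0, 22, 20), (1, 21, 3), (2, 11, 31), (2, 23, 27), (3, 20, 14)]),
     (31, [(0, 29, 20), (1, 28, 3), (2, 30, 27), (3, 27, 14)]), (35, [(0, 29, 24), (0, 33, 20),
     (1, 28, 7), (1, 32, 3), (2, 30, 31), (2, 34, 27), (3, 27, 18), (3, 31, 14)]),
     (36, [(2, 28, 27), (3, 27, 20)])],
    []]

/-- The contracting homotopy in degree `1`. -/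
def homotopy1 : Fin 4 → List (ℕ × List Triple) :=
  ![[(9, [(0, 1, 13), (0, 1, 25), (0, 10, 11), (2, 6, 32)]), (10, [(0, 1, 11)]),
     (26, [(0, 12, 11), (1, 11, 2)])],
    [(6, [(1, 4, 1), (2, 2, 33)]), (13, [(1, 11, 1)]), (17, [(1, 15, 1), (2, 13, 33)]),
     (19, [(0, 12, 12), (1, 11, 10), (1, 25, 1), (2, 23, 33)]), (23, [(0, 26, 22), (1, 21, 1),
     (3, 20, 16)]), (30, [(0, 33, 22), (1, 28, 1), (3, 27, 16)]), (34, [(1, 32, 1), (2, 30, 33)])],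
    [(4, [(0, 1, 24), (2, 2, 27), (2, 6, 31)]), (8, [(0, 5, 24), (2, 6, 27)]), (15, [(0, 22, 14),
     (1, 11, 7), (2, 13, 27)]), (19, [(0, 16, 24), (2, 17, 27)]), (21, [(2, 11, 27)]),
     (25, [(0, 22, 24), (2, 23, 27)]), (32, [(1, 28, 7), (2, 30, 27)])],
    [(35, [(0, 29, 11), (0, 33, 23), (1, 28, 2), (3, 27, 17)]), (36, [(3, 27, 11)])]]

/-- The contracting homotopy in degree `2`. -/
def homotopy2 : Fin 4 → List (ℕ × List Triple) :=
  ![[(5, [(0, 1, 4), (1, 2, 21), (1, 4, 11), (2, 3, 28)]), (9, [(0, 1, 8), (0, 5, 4), (0, 10, 2),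
     (1, 2, 25), (1, 4, 15), (1, 6, 21), (1, 8, 11), (2, 3, 32), (2, 7, 28)]), (16, [(0, 12, 4),
     (1, 13, 21), (1, 15, 11), (1, 23, 19), (1, 25, 21), (2, 14, 28), (2, 24, 34)]),
     (22, [(0, 12, 6), (0, 16, 2), (1, 11, 17), (1, 11, 21), (1, 13, 23), (1, 15, 13),
     (1, 15, 25), (1, 17, 11), (1, 21, 11), (2, 14, 30), (2, 20, 28)]), (26, [(0, 22, 4),
     (1, 11, 25), (1, 17, 15), (1, 21, 15), (1, 23, 21), (1, 25, 11), (2, 20, 32), (2, 24, 28)]),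
     (33, [(0, 29, 4), (1, 30, 21), (1, 32, 11), (2, 31, 28)])],
    [(2, [(0, 1, 1)]), (6, [(0, 1, 5), (0, 5, 1), (1, 2, 22), (1, 4, 12), (2, 3, 29)]),
     (8, [(0, 10, 1)]), (13, [(0, 12, 1)]), (17, [(0, 12, 5), (0, 16, 1), (1, 13, 22),
     (1, 15, 12), (1, 25, 22), (2, 14, 29)]), (19, [(0, 22, 5), (0, 26, 1), (1, 11, 26),
     (1, 17, 16), (1, 21, 16), (1, 23, 22), (1, 25, 12), (2, 20, 33), (2, 24, 29)]),
     (21, [(1, 11, 16), (1, 25, 22)]), (23, [(0, 16, 10), (0, 22, 1), (1, 11, 22), (1, 17, 12),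
     (1, 21, 12), (2, 20, 29)]), (28, [(1, 32, 22)]), (30, [(0, 29, 1)]), (34, [(0, 29, 5),
     (0, 33, 1), (1, 30, 22), (1, 32, 12), (2, 31, 29)])],
    [(4, [(0, 1, 3), (1, 2, 20), (2, 3, 27)]), (6, [(1, 4, 24)]), (8, [(0, 1, 7), (0, 5, 3),
     (1, 2, 24), (1, 4, 14), (1, 6, 20), (2, 3, 31), (2, 7, 27)]), (13, [(1, 11, 24),
     (1, 17, 14), (1, 21, 14), (2, 20, 31)]), (15, [(0, 12, 3), (1, 13, 20), (1, 23, 18),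
     (1, 25, 20), (2, 14, 27), (2, 24, 36)]), (17, [(1, 15, 24)]), (19, [(0, 12, 7), (0, 16, 3),
     (1, 13, 24), (1, 15, 14), (1, 17, 20), (1, 25, 24), (2, 14, 31), (2, 18, 27)]),
     (21, [(1, 11, 20), (2, 20, 27)]), (23, [(1, 19, 14), (1, 21, 24), (2, 18, 31)]),
     (25, [(0, 22, 3), (1, 11, 24), (1, 17, 14), (1, 21, 14), (1, 23, 20), (2, 20, 31),
     (2, 24, 27)]), (28, [(2, 27, 27)]), (32, [(0, 29, 3), (1, 30, 20), (2, 31, 27)]),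
     (34, [(1, 28, 20), (1, 32, 24), (2, 27, 36), (2, 36, 27)])],
    [(3, [(0, 1, 2), (1, 2, 11)]), (7, [(0, 1, 6), (0, 5, 2), (1, 2, 23), (1, 4, 13), (1, 4, 25),
     (1, 6, 11), (2, 3, 30)]), (14, [(0, 12, 2), (0, 22, 4), (1, 13, 11), (1, 23, 21),
     (1, 25, 11), (2, 24, 28)]), (18, [(0, 12, 6), (0, 16, 2), (1, 13, 23), (1, 15, 13),
     (1, 15, 25), (1, 17, 11), (1, 25, 23), (2, 14, 30)]), (20, [(1, 11, 11)]), (24, [(0, 22, 2),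
     (1, 11, 23), (1, 15, 19), (1, 17, 13), (1, 17, 25), (1, 21, 13), (1, 21, 25), (1, 23, 11),
     (2, 20, 30)]), (31, [(0, 29, 2), (1, 30, 11)]), (35, [(0, 29, 6), (0, 33, 2), (1, 28, 21),
     (1, 30, 23), (1, 32, 13), (1, 32, 25), (1, 34, 11), (2, 27, 34), (2, 31, 30), (2, 36, 28)]),
     (36, [(1, 28, 11), (1, 32, 23), (2, 27, 28)])]]

/-- The contracting homotopy in degree `3`. -/
def homotopy3 : Fin 4 → List (ℕ × List ℕ) :=
  ![[(9, [1])],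
    [(19, [11]), (23, [15])],
    [(35, [27])],
    []]

lemma isTable_homotopy0 : IsTable homotopy0 := by decide +kernel
lemma isTable_homotopy1 : IsTable homotopy1 := by decide +kernel
lemma isTable_homotopy2 : IsTable homotopy2 := by decide +kernel
lemma isTable_homotopy3 : IsTable homotopy3 := by decide +kernel

section

variable (K : Type u) [Field K]

lemma sumPaths_append (l l' : List ℕ) :
    sumPaths K (l ++ l') = sumPaths K l + sumPaths K l' := by
  simp [sumPaths]

lemma sumPaths_eq_zero [CharP K 2] {l : List ℕ} (hl : CancelsExcept (· = 0) l) :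
    sumPaths K l = 0 :=
  sum_map_eq_zero K (fun _ h => by rw [h, pathElt_zero]) hl

lemma sumPaths_eq [CharP K 2] {l l' : List ℕ}
    (hl : CancelsExcept (· = 0) (l ++ l')) : sumPaths K l = sumPaths K l' := by
  have h := sumPaths_eq_zero K hl
  rw [sumPaths_append] at h
  have h2 : sumPaths K l' + sumPaths K l' = 0 := by
    rw [← two_smul K, CharTwo.two_eq_zero, zero_smul]
  rw [← add_zero (sumPaths K l), ← h2, ← add_assoc, h, zero_add]

lemma tmul_smul_alg (x a : QuatAlg K) (y : (QuatAlg K)ᵐᵒᵖ) :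
    (x ⊗ₜ[K] y) • a = x * (a * y.unop) :=
  TensorProduct.Algebra.smul_def x y a

lemma freeBimod_smul_smul (e e' : QuatEnv K) (x : FreeBimod K) : e • e' • x = (e * e') • x :=
  smul_smul e e' x

lemma freeBimod_zero_smul (x : FreeBimod K) : (0 : QuatEnv K) • x = 0 :=
  zero_smul (QuatEnv K) x

lemma isScalarTower_freeBimod : IsScalarTower K (QuatEnv K) (FreeBimod K) := inferInstance

lemma zero_smul_alg (a : QuatAlg K) : (0 : QuatEnv K) • a = 0 := zero_smul (QuatEnv K) a

instance : IsScalarTower K (QuatEnv K) (QuatAlg K) where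
  smul_assoc k e a := by
    induction e using TensorProduct.induction_on with
    | zero => rw [smul_zero, zero_smul_alg, smul_zero]
    | add e e' he he' => rw [smul_add, add_smul, he, he', add_smul, smul_add]
    | tmul x y => rw [TensorProduct.smul_tmul', tmul_smul_alg, tmul_smul_alg, smul_mul_assoc]

instance : IsScalarTower K (QuatEnv K) (FreeBimod K) := isScalarTower_freeBimod K

/-- The augmentation. -/
noncomputable def augmentation : FreeBimod K →ₗ[QuatEnv K] QuatAlg K :=
  Finsupp.linearCombination (QuatEnv K) fun j => pathElt K (vertexPath j)

lemma augmentation_sumTriples (l : List Triple) : augmentation K (sumTriples K l) =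
    sumPaths K (l.map fun t => mulIdx t.2.1 (mulIdx (vertexPath t.1) t.2.2)) := by
  rw [sumTriples, map_list_sum, sumPaths, List.map_map, List.map_map]
  congr 2
  funext t
  simp [augmentation, triple, tmul_smul_alg, pathElt_mul_pathElt]

lemma augmentation_comp_eq_zero [CharP K 2] : augmentation K ∘ₗ bimodMap K diff1 = 0 := by
  refine Finsupp.lhom_ext' fun j => LinearMap.ext_ring ?_
  simp only [LinearMap.comp_apply, Finsupp.lsingle_apply, bimodMap_single,
    augmentation_sumTriples, LinearMap.zero_apply]
  refine sumPaths_eq_zero K ?_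
  revert j
  decide +kernel

lemma augmentation_comp_vertexGen [CharP K 2] :
    augmentation K ∘ₗ bimodMap K vertexGen = augmentation K := by
  refine Finsupp.lhom_ext' fun j => LinearMap.ext_ring ?_
  have h : augmentation K (Finsupp.single j 1) = sumPaths K [vertexPath j] := by
    simp [augmentation, sumPaths]
  simp only [LinearMap.comp_apply, Finsupp.lsingle_apply, bimodMap_single,
    augmentation_sumTriples, h]
  refine sumPaths_eq K ?_
  clear h
  revert j
  decide +kernel

lemma casimir_central [CharP K 2] (a : QuatAlg K) :
    (a ⊗ₜ[K] (1 : (QuatAlg K)ᵐᵒᵖ)) • sumTriples K casimir =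
      ((1 : QuatAlg K) ⊗ₜ[K] MulOpposite.op a) • sumTriples K casimir := by
  have h : ∀ i : Fin 36, CancelsExcept Triple.IsNull
      (lmulTriples (i + 1) casimir ++ rmulTriples (i + 1) casimir) := by decide +kernel
  have : ((LinearMap.toSpanSingleton (QuatEnv K) (FreeBimod K)
        (sumTriples K casimir)).restrictScalars K ∘ₗ (TensorProduct.mk K _ _).flip 1) =
      ((LinearMap.toSpanSingleton (QuatEnv K) (FreeBimod K)
        (sumTriples K casimir)).restrictScalars K ∘ₗ TensorProduct.mk K _ _ 1 ∘ₗ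
          (MulOpposite.opLinearEquiv K).toLinearMap) := by
    refine (pathBasis K).ext fun i => ?_
    simpa [tmul_one_smul_sumTriples, one_tmul_smul_sumTriples] using sumTriples_eq K (h i)
  simpa using LinearMap.congr_fun this a

/-- The embedding of the algebra into the term of degree `3`. -/
noncomputable def casimirMap [CharP K 2] : QuatAlg K →ₗ[QuatEnv K] FreeBimod K where
  toFun a := (a ⊗ₜ[K] (1 : (QuatAlg K)ᵐᵒᵖ)) • sumTriples K casimir
  map_add' a c := by rw [TensorProduct.add_tmul, add_smul]
  map_smul' e a := by
    induction e using TensorProduct.induction_on with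
    | zero => rw [zero_smul_alg, TensorProduct.zero_tmul, RingHom.id_apply,
        freeBimod_zero_smul, freeBimod_zero_smul]
    | add e e' he he' =>
      rw [RingHom.id_apply] at he he' ⊢
      rw [add_smul, TensorProduct.add_tmul, add_smul, he, he', add_smul]
    | tmul x y =>
      have h := congrArg (fun w => ((x * a) ⊗ₜ[K] (1 : (QuatAlg K)ᵐᵒᵖ)) • w)
        (casimir_central K y.unop)
      simp only [freeBimod_smul_smul, Algebra.TensorProduct.tmul_mul_tmul, one_mul, mul_one] at h
      simp only [tmul_smul_alg, RingHom.id_apply, freeBimod_smul_smul,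
        Algebra.TensorProduct.tmul_mul_tmul, mul_one, ← mul_assoc, h, MulOpposite.op_unop]

lemma casimirMap_apply [CharP K 2] (a : QuatAlg K) :
    casimirMap K a = (a ⊗ₜ[K] (1 : (QuatAlg K)ᵐᵒᵖ)) • sumTriples K casimir := rfl

lemma casimirMap_sumPaths [CharP K 2] (l : List ℕ) : casimirMap K (sumPaths K l) =
    sumTriples K (l.flatMap fun a => lmulTriples a casimir) := by
  rw [sumTriples_flatMap, sumPaths, map_list_sum, List.map_map]
  congr 2
  funext a
  exact tmul_one_smul_sumTriples K a _

/-- The homomorphism of right modules splitting the embedding of the algebra. -/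
noncomputable def casimirRetraction : FreeBimod K →ₗ[K] QuatAlg K :=
  rightMap K fun j a => sumPaths K (lookup homotopy3 j a)

lemma casimirRetraction_sumTriples (l : List Triple) :
    casimirRetraction K (sumTriples K l) =
      sumPaths K (l.flatMap fun t => (lookup homotopy3 t.1 t.2.1).map fun s =>
        mulIdx s t.2.2) := by
  induction l with
  | nil => simp [sumTriples, sumPaths]
  | cons t l ih =>
    have h : casimirRetraction K (triple K t) =
        sumPaths K ((lookup homotopy3 t.1 t.2.1).map fun s => mulIdx s t.2.2) := by
      rw [casimirRetraction, rightMap_triple, tmul_smul_alg]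
      · simp [sumPaths, Function.comp_def, ← pathElt_mul_pathElt, List.sum_map_mul_right]
      · intro j a ha
        rw [lookup_eq_nil isTable_homotopy3 j ha]
        rfl
    rw [List.flatMap_cons, sumPaths_append, ← ih, ← h, ← map_add]
    simp [sumTriples]

lemma sumPaths_trivial : sumPaths K [1, 11, 27] = 1 := by
  rw [← sum_trivPath]
  simp [sumPaths, Fin.sum_univ_three, trivPath, add_assoc]

lemma casimirRetraction_casimirMap [CharP K 2] (a : QuatAlg K) :
    casimirRetraction K (casimirMap K a) = a := by
  rw [casimirMap_apply, casimir_central]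
  have h := isRightLinear_rightMap K (fun j a => sumPaths K (lookup homotopy3 j a))
    (MulOpposite.op a) (sumTriples K casimir)
  have h1 : casimirRetraction K (sumTriples K casimir) = 1 := by
    rw [casimirRetraction_sumTriples, ← sumPaths_trivial]
    exact sumPaths_eq K (by decide +kernel)
  rw [casimirRetraction] at h1 ⊢
  rw [h, h1, tmul_smul_alg]
  simp

/-- The homomorphism of right modules splitting the augmentation. -/
noncomputable def augmentationSection : QuatAlg K →ₗ[K] FreeBimod K :=
  (LinearMap.toSpanSingleton (QuatEnv K) (FreeBimod K)
      (sumTriples K unitTriples)).restrictScalars K ∘ₗ TensorProduct.mk K _ _ 1 ∘ₗ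
    (MulOpposite.opLinearEquiv K).toLinearMap

lemma augmentationSection_apply (a : QuatAlg K) : augmentationSection K a =
    ((1 : QuatAlg K) ⊗ₜ[K] MulOpposite.op a) • sumTriples K unitTriples := by
  simp [augmentationSection]

lemma augmentationSection_sumPaths (l : List ℕ) : augmentationSection K (sumPaths K l) =
    sumTriples K (l.flatMap fun a => rmulTriples a unitTriples) := by
  rw [sumTriples_flatMap, sumPaths, map_list_sum, List.map_map]
  congr 2
  funext a
  rw [Function.comp_apply, augmentationSection_apply, one_tmul_smul_sumTriples]

lemma augmentation_augmentationSection (a : QuatAlg K) :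
    augmentation K (augmentationSection K a) = a := by
  have h1 : augmentation K (sumTriples K unitTriples) = 1 := by
    rw [augmentation_sumTriples, ← sumPaths_trivial]
    rfl
  rw [augmentationSection_apply, map_smul, h1, tmul_smul_alg]
  simp

end

section

variable (K : Type u) [Field K] [CharP K 2]

lemma homotopy_degree0 (x : FreeBimod K) :
    augmentationSection K (augmentation K x) + bimodMap K diff1 (tableMap K homotopy0 x) +
      bimodMap K vertexGen x = 0 := by
  have hsec : IsRightLinear (augmentationSection K) := fun y a => by
    rw [augmentationSection_apply, augmentationSection_apply, tmul_smul_alg,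
      freeBimod_smul_smul, Algebra.TensorProduct.tmul_mul_tmul]
    simp
  have hR (D) : IsRightLinear ((bimodMap K D).restrictScalars K) :=
    isRightLinear_restrictScalars _
  have haug : IsRightLinear ((augmentation K).restrictScalars K) :=
    isRightLinear_restrictScalars _
  have := ((hsec.comp haug).add ((hR diff1).comp
    (isRightLinear_rightMap K fun j a => sumTriples K (lookup homotopy0 j a)))).add (hR vertexGen)
  refine LinearMap.congr_fun (this.eq_zero fun j a k => ?_) x
  rw [← sumTriples_singleton]
  simp only [LinearMap.add_apply, LinearMap.comp_apply, LinearMap.coe_restrictScalars]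
  rw [← tableMap, augmentation_sumTriples, augmentationSection_sumPaths,
    tableMap_sumTriples K isTable_homotopy0, bimodMap_sumTriples, bimodMap_sumTriples,
    ← sumTriples_append, ← sumTriples_append]
  refine sumTriples_eq_zero K ?_
  revert j a k
  decide +kernel

lemma homotopy_degree1 (x : FreeBimod K) :
    bimodMap K diff2 (tableMap K homotopy1 x) + tableMap K homotopy0 (bimodMap K diff1 x) +
      bimodMap K arrowGen x = 0 :=
  homotopy_eq K isTable_homotopy1 isTable_homotopy0 (by decide +kernel) x

lemma homotopy_degree2 (x : FreeBimod K) :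
    bimodMap K diff3 (tableMap K homotopy2 x) + tableMap K homotopy1 (bimodMap K diff2 x) +
      bimodMap K arrowGen x = 0 :=
  homotopy_eq K isTable_homotopy2 isTable_homotopy1 (by decide +kernel) x

lemma homotopy_degree3 (x : FreeBimod K) :
    casimirMap K (casimirRetraction K x) + tableMap K homotopy2 (bimodMap K diff3 x) +
      bimodMap K vertexGen x = 0 := by
  have hR (D) : IsRightLinear ((bimodMap K D).restrictScalars K) :=
    isRightLinear_restrictScalars _
  have hcas : IsRightLinear ((casimirMap K).restrictScalars K) :=
    isRightLinear_restrictScalars _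
  have := ((hcas.comp (isRightLinear_rightMap K fun j a => sumPaths K
    (lookup homotopy3 j a))).add ((isRightLinear_rightMap K fun j a =>
      sumTriples K (lookup homotopy2 j a)).comp (hR diff3))).add (hR vertexGen)
  refine LinearMap.congr_fun (this.eq_zero fun j a k => ?_) x
  rw [← sumTriples_singleton]
  simp only [LinearMap.add_apply, LinearMap.comp_apply, LinearMap.coe_restrictScalars]
  rw [← tableMap, ← casimirRetraction, casimirRetraction_sumTriples, casimirMap_sumPaths,
    bimodMap_sumTriples, tableMap_sumTriples K isTable_homotopy2, bimodMap_sumTriples,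
    ← sumTriples_append, ← sumTriples_append]
  refine sumTriples_eq_zero K ?_
  revert j a k
  decide +kernel

end

section Restrict

variable {R M : Type*} [Semiring R] [AddCommMonoid M] [Module R M]

lemma exact_restrict {p q r : Submodule R M} {f g : M →ₗ[R] M} (hf : ∀ x ∈ p, f x ∈ q)
    (hg : ∀ x ∈ q, g x ∈ r) (h0 : g ∘ₗ f = 0) (h : ∀ x ∈ q, g x = 0 → ∃ y ∈ p, f y = x) :
    Function.Exact (f.restrict hf) (g.restrict hg) := by
  rintro ⟨x, hx⟩
  constructor
  · intro hgx
    obtain ⟨y, hy, rfl⟩ := h x hx (congrArg Subtype.val hgx)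
    exact ⟨⟨y, hy⟩, rfl⟩
  · rintro ⟨⟨y, hy⟩, hxy⟩
    rw [← hxy]
    exact Subtype.ext (LinearMap.congr_fun h0 y)

lemma mapsTo_range {f e e' : M →ₗ[R] M} (h : e' ∘ₗ f = f) :
    ∀ x ∈ LinearMap.range e, f x ∈ LinearMap.range e' :=
  fun x _ => ⟨f x, LinearMap.congr_fun h x⟩

lemma apply_of_mem_range {e : M →ₗ[R] M} (he : e ∘ₗ e = e) {x : M}
    (hx : x ∈ LinearMap.range e) : e x = x := by
  obtain ⟨y, rfl⟩ := hx
  exact LinearMap.congr_fun he y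

lemma projective_range_of_idempotent [Module.Projective R M] {e : M →ₗ[R] M}
    (he : e ∘ₗ e = e) : Module.Projective R (LinearMap.range e) :=
  Module.Projective.of_split (LinearMap.range e).subtype e.rangeRestrict <|
    LinearMap.ext fun x => Subtype.ext (apply_of_mem_range he x.2)

end Restrict

section

variable (K : Type u) [Field K]

lemma bimodMap_nil : bimodMap K (fun _ => []) = 0 :=
  Finsupp.lhom_ext' fun j => LinearMap.ext_ring <| by simp [bimodMap_single, sumTriples]

lemma freeBimod_smul_zero (e : QuatEnv K) : e • (0 : FreeBimod K) = 0 :=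
  (Module.toDistribMulAction : DistribMulAction (QuatEnv K) (FreeBimod K)).smul_zero e

noncomputable instance (S : Submodule (QuatEnv K) (FreeBimod K)) : AddCommGroup S :=
  Module.addCommMonoidToAddCommGroup (QuatEnv K)

variable [CharP K 2]

lemma vertexGen_comp_vertexGen :
    bimodMap K vertexGen ∘ₗ bimodMap K vertexGen = bimodMap K vertexGen :=
  bimodMap_comp_eq K (by decide +kernel)

lemma arrowGen_comp_arrowGen :
    bimodMap K arrowGen ∘ₗ bimodMap K arrowGen = bimodMap K arrowGen :=
  bimodMap_comp_eq K (by decide +kernel)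

lemma vertexGen_comp_diff1 : bimodMap K vertexGen ∘ₗ bimodMap K diff1 = bimodMap K diff1 :=
  bimodMap_comp_eq K (by decide +kernel)

lemma arrowGen_comp_diff2 : bimodMap K arrowGen ∘ₗ bimodMap K diff2 = bimodMap K diff2 :=
  bimodMap_comp_eq K (by decide +kernel)

lemma arrowGen_comp_diff3 : bimodMap K arrowGen ∘ₗ bimodMap K diff3 = bimodMap K diff3 :=
  bimodMap_comp_eq K (by decide +kernel)

lemma diff1_comp_arrowGen : bimodMap K diff1 ∘ₗ bimodMap K arrowGen = bimodMap K diff1 :=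
  bimodMap_comp_eq K (by decide +kernel)

lemma diff2_comp_arrowGen : bimodMap K diff2 ∘ₗ bimodMap K arrowGen = bimodMap K diff2 :=
  bimodMap_comp_eq K (by decide +kernel)

lemma diff3_comp_vertexGen : bimodMap K diff3 ∘ₗ bimodMap K vertexGen = bimodMap K diff3 :=
  bimodMap_comp_eq K (by decide +kernel)

lemma diff1_comp_diff2 : bimodMap K diff1 ∘ₗ bimodMap K diff2 = 0 := by
  rw [← bimodMap_nil]
  exact bimodMap_comp_eq K (by decide +kernel)

lemma diff2_comp_diff3 : bimodMap K diff2 ∘ₗ bimodMap K diff3 = 0 := by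
  rw [← bimodMap_nil]
  exact bimodMap_comp_eq K (by decide +kernel)

lemma vertexGen_casimirMap (a : QuatAlg K) :
    bimodMap K vertexGen (casimirMap K a) = casimirMap K a := by
  rw [casimirMap_apply, map_smul, bimodMap_sumTriples]
  exact congrArg _ (sumTriples_eq K (by decide +kernel))

lemma diff3_casimirMap (a : QuatAlg K) : bimodMap K diff3 (casimirMap K a) = 0 := by
  rw [casimirMap_apply, map_smul, bimodMap_sumTriples, sumTriples_eq_zero K (by decide +kernel)]
  exact freeBimod_smul_zero K _

lemma eq_of_add_eq_zero {x y : FreeBimod K} (h : x + y = 0) : x = y := by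
  have h2 : y + y = 0 := by rw [← two_smul K, CharTwo.two_eq_zero, zero_smul]
  rw [← add_zero x, ← h2, ← add_assoc, h, zero_add]

/-- The bimodule in degrees `0` and `3` of the minimal resolution. -/
noncomputable abbrev vertexModule : Submodule (QuatEnv K) (FreeBimod K) :=
  LinearMap.range (bimodMap K vertexGen)

/-- The bimodule in degrees `1` and `2` of the minimal resolution. -/
noncomputable abbrev arrowModule : Submodule (QuatEnv K) (FreeBimod K) :=
  LinearMap.range (bimodMap K arrowGen)

instance : Module.Projective (QuatEnv K) (vertexModule K) :=
  projective_range_of_idempotent (vertexGen_comp_vertexGen K)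

instance : Module.Projective (QuatEnv K) (arrowModule K) :=
  projective_range_of_idempotent (arrowGen_comp_arrowGen K)

/-- The differential of degree `1` of the minimal resolution. -/
noncomputable def resDiff1 : arrowModule K →ₗ[QuatEnv K] vertexModule K :=
  (bimodMap K diff1).restrict (mapsTo_range (vertexGen_comp_diff1 K))

/-- The differential of degree `2` of the minimal resolution. -/
noncomputable def resDiff2 : arrowModule K →ₗ[QuatEnv K] arrowModule K :=
  (bimodMap K diff2).restrict (mapsTo_range (arrowGen_comp_diff2 K))

/-- The differential of degree `3` of the minimal resolution. -/
noncomputable def resDiff3 : vertexModule K →ₗ[QuatEnv K] arrowModule K :=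
  (bimodMap K diff3).restrict (mapsTo_range (arrowGen_comp_diff3 K))

/-- The augmentation of the minimal resolution. -/
noncomputable def resAugmentation : vertexModule K →ₗ[QuatEnv K] QuatAlg K :=
  (augmentation K).domRestrict (vertexModule K)

/-- The embedding of the third syzygy into the minimal resolution. -/
noncomputable def resEmbedding : QuatAlg K →ₗ[QuatEnv K] vertexModule K :=
  (casimirMap K).codRestrict (vertexModule K) fun a => ⟨_, vertexGen_casimirMap K a⟩

lemma resEmbedding_injective : Function.Injective (resEmbedding K) := fun a c h => by
  rw [← casimirRetraction_casimirMap K a, ← casimirRetraction_casimirMap K c]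
  exact congrArg (casimirRetraction K) (congrArg Subtype.val h)

lemma resAugmentation_surjective : Function.Surjective (resAugmentation K) := fun a =>
  ⟨⟨bimodMap K vertexGen (augmentationSection K a), ⟨_, rfl⟩⟩,
    (LinearMap.congr_fun (augmentation_comp_vertexGen K) _).trans
      (augmentation_augmentationSection K a)⟩

lemma exact_resDiff1_resAugmentation :
    Function.Exact (resDiff1 K) (resAugmentation K) := by
  rintro ⟨x, hx⟩
  constructor
  · intro h
    have h0 : augmentation K x = 0 := h
    have hom := homotopy_degree0 K x
    rw [h0, map_zero, zero_add, apply_of_mem_range (vertexGen_comp_vertexGen K) hx] at hom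
    exact ⟨⟨bimodMap K arrowGen (tableMap K homotopy0 x), ⟨_, rfl⟩⟩, Subtype.ext <|
      (LinearMap.congr_fun (diff1_comp_arrowGen K) _).trans (eq_of_add_eq_zero K hom)⟩
  · rintro ⟨y, hy⟩
    rw [← hy]
    exact LinearMap.congr_fun (augmentation_comp_eq_zero K) y.1

lemma exact_resDiff2_resDiff1 : Function.Exact (resDiff2 K) (resDiff1 K) := by
  refine exact_restrict _ _ (diff1_comp_diff2 K) fun x hx h0 => ?_
  have hom := homotopy_degree1 K x
  rw [h0, map_zero, add_zero, apply_of_mem_range (arrowGen_comp_arrowGen K) hx] at hom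
  exact ⟨bimodMap K arrowGen (tableMap K homotopy1 x), ⟨_, rfl⟩,
    (LinearMap.congr_fun (diff2_comp_arrowGen K) _).trans (eq_of_add_eq_zero K hom)⟩

lemma exact_resDiff3_resDiff2 : Function.Exact (resDiff3 K) (resDiff2 K) := by
  refine exact_restrict _ _ (diff2_comp_diff3 K) fun x hx h0 => ?_
  have hom := homotopy_degree2 K x
  rw [h0, map_zero, add_zero, apply_of_mem_range (arrowGen_comp_arrowGen K) hx] at hom
  exact ⟨bimodMap K vertexGen (tableMap K homotopy2 x), ⟨_, rfl⟩,
    (LinearMap.congr_fun (diff3_comp_vertexGen K) _).trans (eq_of_add_eq_zero K hom)⟩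

lemma exact_resEmbedding_resDiff3 : Function.Exact (resEmbedding K) (resDiff3 K) := by
  rintro ⟨x, hx⟩
  constructor
  · intro h
    have h0 : bimodMap K diff3 x = 0 := congrArg Subtype.val h
    have hom := homotopy_degree3 K x
    rw [h0, map_zero, add_zero, apply_of_mem_range (vertexGen_comp_vertexGen K) hx] at hom
    exact ⟨casimirRetraction K x, Subtype.ext (eq_of_add_eq_zero K hom)⟩
  · rintro ⟨y, hy⟩
    rw [← hy]
    exact Subtype.ext (diff3_casimirMap K y)

lemma hasBimodPeriodicRes4 : HasBimodPeriodicRes4 K :=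
  ⟨.of _ (vertexModule K), .of _ (arrowModule K), .of _ (arrowModule K), .of _ (vertexModule K),
    ModuleCat.ofHom (resEmbedding K), ModuleCat.ofHom (resDiff3 K), ModuleCat.ofHom (resDiff2 K),
    ModuleCat.ofHom (resDiff1 K), ModuleCat.ofHom (resAugmentation K),
    inferInstanceAs (Module.Projective (QuatEnv K) (vertexModule K)),
    inferInstanceAs (Module.Projective (QuatEnv K) (arrowModule K)),
    inferInstanceAs (Module.Projective (QuatEnv K) (arrowModule K)),
    inferInstanceAs (Module.Projective (QuatEnv K) (vertexModule K)),
    resEmbedding_injective K, resAugmentation_surjective K, exact_resEmbedding_resDiff3 K,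
    exact_resDiff3_resDiff2 K, exact_resDiff2_resDiff1 K, exact_resDiff1_resAugmentation K⟩

end
end QuatAlg

namespace ModuleCat

open CategoryTheory Abelian

variable {R : Type u} [Ring R]

lemma subsingleton_ext_add_two_iff {S : ShortComplex (ModuleCat.{u} R)} (hS : S.ShortExact)
    [Module.Projective R S.X₂] (M : ModuleCat.{u} R) (n : ℕ) :
    Subsingleton (Ext S.X₃ M (n + 2)) ↔ Subsingleton (Ext S.X₁ M (n + 1)) := by
  have hP : Projective S.X₂ := S.X₂.projective_of_categoryTheory_projective
  constructor <;> intro h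
  · refine subsingleton_of_forall_eq 0 fun x => ?_
    obtain ⟨x₂, rfl⟩ := Ext.contravariant_sequence_exact₁ hS M x
      (show 1 + (n + 1) = n + 2 by lia) (Subsingleton.elim _ _)
    rw [Ext.eq_zero_of_projective x₂, Ext.comp_zero]
  · refine subsingleton_of_forall_eq 0 fun x => ?_
    obtain ⟨x₁, rfl⟩ := Ext.contravariant_sequence_exact₃ hS M x
      (Ext.eq_zero_of_projective _) (show 1 + (n + 1) = n + 2 by lia)
    rw [Subsingleton.elim x₁ 0, Ext.comp_zero]

lemma subsingleton_ext_one_iff {S : ShortComplex (ModuleCat.{u} R)} (hS : S.ShortExact)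
    [Module.Projective R S.X₂] (M : ModuleCat.{u} R) :
    Subsingleton (Ext S.X₃ M 1) ↔ ∀ h : S.X₁ ⟶ M, ∃ k : S.X₂ ⟶ M, S.f ≫ k = h := by
  have hP : Projective S.X₂ := S.X₂.projective_of_categoryTheory_projective
  constructor <;> intro h
  · intro f
    obtain ⟨x₂, hx₂⟩ := Ext.contravariant_sequence_exact₁ hS M (Ext.mk₀ f) (add_zero 1)
      (Subsingleton.elim _ _)
    obtain ⟨k, rfl⟩ := (Ext.mk₀_bijective _ _).2 x₂
    rw [Ext.mk₀_comp_mk₀] at hx₂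
    exact ⟨k, (Ext.mk₀_bijective _ _).1 hx₂⟩
  · refine subsingleton_of_forall_eq 0 fun x => ?_
    obtain ⟨x₁, rfl⟩ := Ext.contravariant_sequence_exact₃ hS M x
      (Ext.eq_zero_of_projective _) (add_zero 1)
    obtain ⟨f, rfl⟩ := (Ext.mk₀_bijective _ _).2 x₁
    obtain ⟨k, rfl⟩ := h f
    rw [← Ext.mk₀_comp_mk₀, hS.extClass_comp_assoc]

variable {A B X P Q M : ModuleCat.{u} R}

section ShortSequence

variable {f : X ⟶ P} {g : P ⟶ A} [Module.Projective R P]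

lemma subsingleton_ext_add_two_iff_of_exact (hf : Function.Injective f)
    (hfg : Function.Exact f g) (hg : Function.Surjective g) (M : ModuleCat.{u} R) (n : ℕ) :
    Subsingleton (Ext A M (n + 2)) ↔ Subsingleton (Ext X M (n + 1)) :=
  have hS := ModuleCat.shortComplex_shortExact (.mk f g (by ext x; exact hfg.apply_apply_eq_zero x))
    hfg hf hg
  subsingleton_ext_add_two_iff hS M n

lemma subsingleton_ext_one_iff_of_exact (hf : Function.Injective f)
    (hfg : Function.Exact f g) (hg : Function.Surjective g) (M : ModuleCat.{u} R) :
    Subsingleton (Ext A M 1) ↔ ∀ h : X ⟶ M, ∃ k : P ⟶ M, f ≫ k = h :=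
  have hS := ModuleCat.shortComplex_shortExact (.mk f g (by ext x; exact hfg.apply_apply_eq_zero x))
    hfg hf hg
  subsingleton_ext_one_iff hS M

end ShortSequence

/-- The kernel of a homomorphism of modules. -/
abbrev kerObj (g : P ⟶ A) : ModuleCat.{u} R := ModuleCat.of R (LinearMap.ker g.hom)

/-- The inclusion of the kernel of a homomorphism of modules. -/
abbrev kerIncl (g : P ⟶ A) : kerObj g ⟶ P := ModuleCat.ofHom (LinearMap.ker g.hom).subtype

/-- The homomorphism to the kernel of the second map in an exact sequence. -/
abbrev kerLift {f : Q ⟶ P} {g : P ⟶ A} (h : Function.Exact f g) : Q ⟶ kerObj g :=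
  ModuleCat.ofHom (f.hom.codRestrict _ h.apply_apply_eq_zero)

lemma kerIncl_injective (g : P ⟶ A) : Function.Injective (kerIncl g) := Subtype.val_injective

lemma exact_kerIncl (g : P ⟶ A) : Function.Exact (kerIncl g) g := fun x =>
  ⟨fun h => ⟨⟨x, h⟩, rfl⟩, by rintro ⟨y, rfl⟩; exact y.2⟩

lemma kerLift_surjective {f : Q ⟶ P} {g : P ⟶ A} (h : Function.Exact f g) :
    Function.Surjective (kerLift h) := by
  rintro ⟨x, hx⟩
  obtain ⟨y, rfl⟩ := (h x).1 hx
  exact ⟨y, rfl⟩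

lemma exact_kerLift {e : X ⟶ Q} {f : Q ⟶ P} {g : P ⟶ A} (he : Function.Exact e f)
    (h : Function.Exact f g) : Function.Exact e (kerLift h) := fun x =>
  ⟨fun hx => (he x).1 (congrArg Subtype.val hx), fun hx => Subtype.ext ((he x).2 hx)⟩

variable {P₀ P₁ P₂ P₃ : ModuleCat.{u} R} [Module.Projective R P₀]

lemma subsingleton_ext_add_three_iff [Module.Projective R P₁]
    {ι : B ⟶ P₁} {d₁ : P₁ ⟶ P₀} {ε : P₀ ⟶ A}
    (hι : Function.Injective ι) (hε : Function.Surjective ε) (h₁ : Function.Exact ι d₁)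
    (h₀ : Function.Exact d₁ ε) (M : ModuleCat.{u} R) (n : ℕ) :
    Subsingleton (Ext A M (n + 3)) ↔ Subsingleton (Ext B M (n + 1)) := by
  rw [subsingleton_ext_add_two_iff_of_exact (kerIncl_injective ε) (exact_kerIncl ε) hε M (n + 1),
    subsingleton_ext_add_two_iff_of_exact hι (exact_kerLift h₁ h₀) (kerLift_surjective h₀)]

lemma subsingleton_ext_add_four_iff [Module.Projective R P₁] [Module.Projective R P₂]
    {ι : B ⟶ P₂} {d₂ : P₂ ⟶ P₁} {d₁ : P₁ ⟶ P₀} {ε : P₀ ⟶ A}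
    (hι : Function.Injective ι) (hε : Function.Surjective ε) (h₂ : Function.Exact ι d₂)
    (h₁ : Function.Exact d₂ d₁) (h₀ : Function.Exact d₁ ε) (M : ModuleCat.{u} R) (n : ℕ) :
    Subsingleton (Ext A M (n + 4)) ↔ Subsingleton (Ext B M (n + 1)) := by
  rw [subsingleton_ext_add_two_iff_of_exact (kerIncl_injective ε) (exact_kerIncl ε) hε M (n + 2),
    subsingleton_ext_add_three_iff hι (kerLift_surjective h₀) h₂ (exact_kerLift h₁ h₀)]

lemma hom_ext_of_surjective {f : Q ⟶ P} (hf : Function.Surjective f) {h k : P ⟶ M}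
    (H : f ≫ h = f ≫ k) : h = k := by
  have : Epi f := (ModuleCat.epi_iff_surjective f).2 hf
  exact (cancel_epi f).1 H

section Resolution

variable {ι : B ⟶ P₃} {d₃ : P₃ ⟶ P₂} {d₂ : P₂ ⟶ P₁} {d₁ : P₁ ⟶ P₀} {ε : P₀ ⟶ A}

lemma subsingleton_ext_one (hε : Function.Surjective ε) (h₀ : Function.Exact d₁ ε)
    (hP₁ : ∀ f : P₁ ⟶ M, f = 0) : Subsingleton (Ext A M 1) := by
  rw [subsingleton_ext_one_iff_of_exact (kerIncl_injective ε) (exact_kerIncl ε) hε]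
  refine fun h => ⟨0, hom_ext_of_surjective (kerLift_surjective h₀) ?_⟩
  rw [hP₁ (kerLift h₀ ≫ h), hP₁ (_ ≫ _)]

lemma not_subsingleton_ext_three [Module.Projective R P₁] [Module.Projective R P₂]
    (hε : Function.Surjective ε) (h₃ : Function.Exact ι d₃)
    (h₂ : Function.Exact d₃ d₂) (h₁ : Function.Exact d₂ d₁) (h₀ : Function.Exact d₁ ε)
    (hP₂ : ∀ f : P₂ ⟶ M, f = 0) (hι : ∀ f : P₃ ⟶ M, ι ≫ f = 0) {f : P₃ ⟶ M} (hf : f ≠ 0) :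
    ¬ Subsingleton (Ext A M 3) := by
  rw [subsingleton_ext_add_three_iff (kerIncl_injective d₁) hε (exact_kerIncl d₁) h₀ M 0,
    subsingleton_ext_one_iff_of_exact (kerIncl_injective _) (exact_kerIncl _)
      (kerLift_surjective h₁)]
  intro H
  have h₂' := exact_kerLift h₂ h₁
  have hs := kerLift_surjective h₂'
  obtain ⟨φ, hφ⟩ : ∃ φ : kerObj (kerLift h₁) ⟶ M, kerLift h₂' ≫ φ = f := by
    have hle : LinearMap.ker (kerLift h₂').hom ≤ LinearMap.ker f.hom := by
      intro x hx
      obtain ⟨y, rfl⟩ := (exact_kerLift h₃ h₂' x).1 hx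
      exact ConcreteCategory.congr_hom (hι f) y
    refine ⟨ModuleCat.ofHom ((LinearMap.ker (kerLift h₂').hom).liftQ f.hom hle ∘ₗ
      ((kerLift h₂').hom.quotKerEquivOfSurjective hs).symm.toLinearMap), ?_⟩
    ext x
    simp only [ModuleCat.hom_comp, LinearMap.comp_apply, ModuleCat.hom_ofHom,
      LinearEquiv.coe_coe]
    have : ((kerLift h₂').hom.quotKerEquivOfSurjective hs).symm ((kerLift h₂').hom x) =
        Submodule.Quotient.mk x := by
      rw [LinearEquiv.symm_apply_eq]
      rfl
    exact (congrArg _ this).trans (Submodule.liftQ_apply _ _ _)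
  obtain ⟨k, hk⟩ := H φ
  rw [hP₂ k, Limits.comp_zero] at hk
  rw [← hφ, ← hk, Limits.comp_zero] at hf
  exact hf rfl

lemma not_subsingleton_ext_four [Module.Projective R P₁] [Module.Projective R P₂]
    [Module.Projective R P₃] (hinj : Function.Injective ι) (hε : Function.Surjective ε)
    (h₃ : Function.Exact ι d₃) (h₂ : Function.Exact d₃ d₂) (h₁ : Function.Exact d₂ d₁)
    (h₀ : Function.Exact d₁ ε) (hι : ∀ f : P₃ ⟶ M, ι ≫ f = 0) {f : B ⟶ M} (hf : f ≠ 0) :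
    ¬ Subsingleton (Ext A M 4) := by
  rw [subsingleton_ext_add_four_iff (kerIncl_injective d₂) hε (exact_kerIncl d₂) h₁ h₀ M 0,
    subsingleton_ext_one_iff_of_exact hinj (exact_kerLift h₃ h₂) (kerLift_surjective h₂)]
  intro H
  obtain ⟨k, hk⟩ := H f
  exact hf (hk.symm.trans (hι k))

end Resolution

end ModuleCat

namespace QuatAlg

open QGen TensorProduct CategoryTheory Abelian ModuleCat

section

variable (K : Type u) [Field K]

/-- Whether a generator is the vertex `1`. -/
def isFirstVertex : QGen → Bool
  | v1 => true
  | _ => false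

/-- The character of the algebra supported at the vertex `1`. -/
noncomputable def character : QuatAlg K →ₐ[K] K :=
  RingQuot.liftAlgHom K ⟨FreeAlgebra.lift K fun g => if isFirstVertex g then 1 else 0, by
    intro x y hxy
    cases hxy <;> simp [isFirstVertex]⟩

lemma character_qgen (g : QGen) : character K (qgen K g) = if isFirstVertex g then 1 else 0 := by
  simp [character, qgen]

lemma character_pathElt_one : character K (pathElt K 1) = 1 := by
  simp [pathElt, pathWord, pathWords, wordElt, character_qgen, isFirstVertex]

lemma character_pathElt {a : ℕ} (ha : a ≠ 1) : character K (pathElt K a) = 0 := by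
  by_cases h : a = 0 ∨ 37 ≤ a
  · rcases h with rfl | h
    · rw [pathElt_zero, map_zero]
    · rw [pathElt_of_le K h, map_zero]
  · obtain ⟨i, rfl⟩ : ∃ i : Fin 36, a = i + 1 := ⟨⟨a - 1, by lia⟩, by simp; lia⟩
    have hw : pathElt K (i + 1) = wordElt K pathWords[i] := by
      have : pathWords[i.val]? = some pathWords[i] := List.getElem?_eq_getElem _
      simp [pathElt, pathWord, this]
    have key : ∀ i : Fin 36, i.val + 1 ≠ 1 → ∃ g ∈ pathWords[i], isFirstVertex g = false := by decide +kernel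
    obtain ⟨g, hg, hg1⟩ := key i ha
    rw [hw, wordElt, map_list_prod]
    refine List.prod_eq_zero (List.mem_map.2 ⟨qgen K g, List.mem_map.2 ⟨g, hg, rfl⟩, ?_⟩)
    rw [character_qgen, hg1, if_neg Bool.false_ne_true]

/-- The character of the enveloping algebra supported at the vertex `(1, 1)`. -/
noncomputable def envCharacter : QuatEnv K →ₐ[K] K :=
  Algebra.TensorProduct.lift (character K)
    ((AlgEquiv.toOpposite K K).symm.toAlgHom.comp (AlgHom.op (character K)))
    fun _ _ => Commute.all _ _

lemma envCharacter_tmul (x : QuatAlg K) (y : (QuatAlg K)ᵐᵒᵖ) :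
    envCharacter K (x ⊗ₜ y) = character K x * character K y.unop := by
  simp [envCharacter]

/-- The simple bimodule at the vertex `(1, 1)`. -/
noncomputable def simpleBimod : ModuleCat.{u} (QuatEnv K) :=
  (ModuleCat.restrictScalars (envCharacter K).toRingHom).obj (ModuleCat.of K K)

/-- The identification of the underlying additive group of the simple bimodule. -/
noncomputable def simpleEquiv : simpleBimod K ≃+ K := AddEquiv.refl K

lemma simpleEquiv_smul (e : QuatEnv K) (x : simpleBimod K) :
    simpleEquiv K (e • x) = envCharacter K e * simpleEquiv K x := rfl

variable {K}

lemma simple_smul_eq_zero {e : QuatEnv K} (h : envCharacter K e = 0) (x : simpleBimod K) :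
    e • x = 0 := by
  apply (simpleEquiv K).injective
  rw [simpleEquiv_smul, h, zero_mul, map_zero]

lemma map_triple_eq_zero (G : FreeBimod K →ₗ[QuatEnv K] simpleBimod K) {t : Triple}
    (ht : t.2.1 ≠ 1 ∨ t.2.2 ≠ 1) : G (triple K t) = 0 := by
  have h : triple K t = (pathElt K t.2.1 ⊗ₜ[K] MulOpposite.op (pathElt K t.2.2)) •
      Finsupp.single t.1 (1 : QuatEnv K) := by
    rw [triple, Finsupp.smul_single, smul_eq_mul, mul_one]
  rw [h, map_smul]
  refine simple_smul_eq_zero ?_ _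
  rw [envCharacter_tmul, MulOpposite.unop_op]
  rcases ht with ht | ht <;> simp [character_pathElt K ht]

lemma map_sumTriples_eq_zero (G : FreeBimod K →ₗ[QuatEnv K] simpleBimod K) {l : List Triple}
    (hl : ∀ t ∈ l, t.2.1 ≠ 1 ∨ t.2.2 ≠ 1) : G (sumTriples K l) = 0 := by
  rw [sumTriples, map_list_sum]
  refine List.sum_eq_zero fun x hx => ?_
  simp only [List.map_map, List.mem_map, Function.comp_apply] at hx
  obtain ⟨t, ht, rfl⟩ := hx
  exact map_triple_eq_zero G (hl t ht)

lemma arrowModule_hom_eq_zero [CharP K 2]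
    (f : ModuleCat.of (QuatEnv K) (arrowModule K) ⟶ simpleBimod K) : f = 0 := by
  have h : f.hom ∘ₗ (bimodMap K arrowGen).rangeRestrict = 0 := by
    refine Finsupp.lhom_ext' fun j => LinearMap.ext_ring ?_
    have hj : (bimodMap K arrowGen).rangeRestrict (Finsupp.single j 1) =
        (bimodMap K arrowGen).rangeRestrict (sumTriples K (arrowGen j)) := by
      refine Subtype.ext ?_
      change bimodMap K arrowGen _ = bimodMap K arrowGen _
      rw [← bimodMap_single]
      exact (LinearMap.congr_fun (arrowGen_comp_arrowGen K) _).symm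
    rw [LinearMap.comp_apply, LinearMap.comp_apply, Finsupp.lsingle_apply, hj]
    exact map_sumTriples_eq_zero (f.hom ∘ₗ (bimodMap K arrowGen).rangeRestrict)
      (by clear hj; revert j; decide +kernel)
  ext ⟨_, x, rfl⟩
  exact LinearMap.congr_fun h x

lemma resEmbedding_comp_eq_zero [CharP K 2]
    (f : ModuleCat.of (QuatEnv K) (vertexModule K) ⟶ simpleBimod K) :
    (ModuleCat.ofHom (resEmbedding K) : quatBimod K ⟶ _) ≫ f = 0 := by
  set G := f.hom ∘ₗ (bimodMap K vertexGen).rangeRestrict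
  have h : G (sumTriples K casimir) = 0 := map_sumTriples_eq_zero G (by decide +kernel)
  ext a
  have ha : resEmbedding K a = (bimodMap K vertexGen).rangeRestrict (casimirMap K a) :=
    Subtype.ext (vertexGen_casimirMap K a).symm
  change f.hom (resEmbedding K a) = 0
  rw [ha]
  change G (casimirMap K a) = 0
  rw [casimirMap_apply, map_smul, h, smul_zero]

lemma exists_vertexModule_hom_ne_zero [CharP K 2] :
    ∃ f : ModuleCat.of (QuatEnv K) (vertexModule K) ⟶ simpleBimod K, f ≠ 0 := by
  let G : FreeBimod K →ₗ[QuatEnv K] simpleBimod K :=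
    Finsupp.linearCombination (QuatEnv K) fun _ => (simpleEquiv K).symm 1
  refine ⟨ModuleCat.ofHom (Y := simpleBimod K) (G ∘ₗ (vertexModule K).subtype), fun h => ?_⟩
  have h1 : G (sumTriples K (vertexGen 0)) = 0 :=
    ConcreteCategory.congr_hom h ⟨_, Finsupp.single 0 1, bimodMap_single K vertexGen 0⟩
  have h2 : sumTriples K (vertexGen 0) = triple K (0, 1, 1) := sumTriples_singleton K _
  rw [h2, triple, Finsupp.linearCombination_single] at h1
  have h3 := congrArg (simpleEquiv K) h1
  rw [simpleEquiv_smul, AddEquiv.apply_symm_apply, envCharacter_tmul, map_zero,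
    MulOpposite.unop_op, character_pathElt_one] at h3
  simp at h3

lemma exists_quatBimod_hom_ne_zero : ∃ f : quatBimod K ⟶ simpleBimod K, f ≠ 0 := by
  let π : QuatAlg K →ₗ[QuatEnv K] simpleBimod K :=
    { toFun := fun a => (simpleEquiv K).symm (character K a)
      map_add' := fun a c => by rw [map_add, map_add]
      map_smul' := fun e a => by
        apply (simpleEquiv K).injective
        rw [RingHom.id_apply, simpleEquiv_smul, AddEquiv.apply_symm_apply,
          AddEquiv.apply_symm_apply]
        induction e using TensorProduct.induction_on with
        | zero => rw [zero_smul_alg, map_zero, map_zero, zero_mul]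
        | add e e' he he' => rw [add_smul, map_add, map_add, add_mul, he, he']
        | tmul x y =>
          rw [tmul_smul_alg, map_mul, map_mul, envCharacter_tmul]
          ring }
  refine ⟨ModuleCat.ofHom (Y := simpleBimod K) π, fun h => ?_⟩
  have h1 : simpleEquiv K (π 1) = 0 :=
    congrArg (simpleEquiv K) (ConcreteCategory.congr_hom h (1 : QuatAlg K))
  change simpleEquiv K ((simpleEquiv K).symm (character K 1)) = 0 at h1
  rw [AddEquiv.apply_symm_apply, map_one] at h1
  exact one_ne_zero h1

variable (K) [CharP K 2]

lemma subsingleton_ext_one_simpleBimod : Subsingleton (Ext (quatBimod K) (simpleBimod K) 1) :=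
  have : Module.Projective (QuatEnv K) (ModuleCat.of (QuatEnv K) (vertexModule K)) :=
    inferInstanceAs (Module.Projective (QuatEnv K) (vertexModule K))
  subsingleton_ext_one (d₁ := ModuleCat.ofHom (resDiff1 K))
    (ε := ModuleCat.ofHom (resAugmentation K)) (resAugmentation_surjective K)
    (exact_resDiff1_resAugmentation K) arrowModule_hom_eq_zero

lemma not_subsingleton_ext_three_simpleBimod :
    ¬ Subsingleton (Ext (quatBimod K) (simpleBimod K) 3) := by
  have : Module.Projective (QuatEnv K) (ModuleCat.of (QuatEnv K) (vertexModule K)) :=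
    inferInstanceAs (Module.Projective (QuatEnv K) (vertexModule K))
  have : Module.Projective (QuatEnv K) (ModuleCat.of (QuatEnv K) (arrowModule K)) :=
    inferInstanceAs (Module.Projective (QuatEnv K) (arrowModule K))
  obtain ⟨f, hf⟩ := exists_vertexModule_hom_ne_zero (K := K)
  exact not_subsingleton_ext_three (ι := ModuleCat.ofHom (resEmbedding K))
    (d₃ := ModuleCat.ofHom (resDiff3 K)) (d₂ := ModuleCat.ofHom (resDiff2 K))
    (d₁ := ModuleCat.ofHom (resDiff1 K)) (ε := ModuleCat.ofHom (resAugmentation K))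
    (resAugmentation_surjective K) (exact_resEmbedding_resDiff3 K) (exact_resDiff3_resDiff2 K)
    (exact_resDiff2_resDiff1 K) (exact_resDiff1_resAugmentation K) arrowModule_hom_eq_zero
    resEmbedding_comp_eq_zero hf

lemma not_subsingleton_ext_four_simpleBimod :
    ¬ Subsingleton (Ext (quatBimod K) (simpleBimod K) 4) := by
  have : Module.Projective (QuatEnv K) (ModuleCat.of (QuatEnv K) (vertexModule K)) :=
    inferInstanceAs (Module.Projective (QuatEnv K) (vertexModule K))
  have : Module.Projective (QuatEnv K) (ModuleCat.of (QuatEnv K) (arrowModule K)) :=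
    inferInstanceAs (Module.Projective (QuatEnv K) (arrowModule K))
  obtain ⟨f, hf⟩ := exists_quatBimod_hom_ne_zero (K := K)
  exact not_subsingleton_ext_four (ι := ModuleCat.ofHom (resEmbedding K))
    (d₃ := ModuleCat.ofHom (resDiff3 K)) (d₂ := ModuleCat.ofHom (resDiff2 K))
    (d₁ := ModuleCat.ofHom (resDiff1 K)) (ε := ModuleCat.ofHom (resAugmentation K))
    (resEmbedding_injective K) (resAugmentation_surjective K) (exact_resEmbedding_resDiff3 K)
    (exact_resDiff3_resDiff2 K) (exact_resDiff2_resDiff1 K) (exact_resDiff1_resAugmentation K)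
    resEmbedding_comp_eq_zero hf

lemma not_hasBimodPeriodicRes1 : ¬ HasBimodPeriodicRes1 K := by
  rintro ⟨P₀, ι, ε, _, hι, hε, h⟩
  apply not_subsingleton_ext_three_simpleBimod K
  rw [subsingleton_ext_add_two_iff_of_exact hι h hε, subsingleton_ext_add_two_iff_of_exact hι h hε]
  exact subsingleton_ext_one_simpleBimod K

lemma not_hasBimodPeriodicRes2 : ¬ HasBimodPeriodicRes2 K := by
  rintro ⟨P₀, P₁, ι, d₁, ε, _, _, hι, hε, h₁, h₀⟩
  apply not_subsingleton_ext_three_simpleBimod K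
  rw [subsingleton_ext_add_three_iff hι hε h₁ h₀]
  exact subsingleton_ext_one_simpleBimod K

lemma not_hasBimodPeriodicRes3 : ¬ HasBimodPeriodicRes3 K := by
  rintro ⟨P₀, P₁, P₂, ι, d₂, d₁, ε, _, _, _, hι, hε, h₂, h₁, h₀⟩
  apply not_subsingleton_ext_four_simpleBimod K
  rw [subsingleton_ext_add_four_iff hι hε h₂ h₁ h₀]
  exact subsingleton_ext_one_simpleBimod K

end
end QuatAlg

/-- Over any field `K` of characteristic two, the algebra `A = Q(3A)₂²`
of quaternion type is periodic of period `4` as a bimodule: there is an exact sequence of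
`A`-`A`-bimodules `0 → A → P₃ → P₂ → P₁ → P₀ → A → 0` in which every `Pᵢ` is a projective
bimodule, and no such exact sequence of shorter positive length exists. -/
theorem quatAlg_bimodule_periodic_of_period_four (K : Type u) [Field K] [CharP K 2] :
    HasBimodPeriodicRes4 K ∧
    ¬ HasBimodPeriodicRes1 K ∧ ¬ HasBimodPeriodicRes2 K ∧ ¬ HasBimodPeriodicRes3 K :=
  ⟨QuatAlg.hasBimodPeriodicRes4 K, QuatAlg.not_hasBimodPeriodicRes1 K,
    QuatAlg.not_hasBimodPeriodicRes2 K, QuatAlg.not_hasBimodPeriodicRes3 K⟩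
end

section
/- Let A be a finite-dimensional algebra over a field K. Then the dominant dimension of A equals the dominant dimension of the opposite algebra A^op. -/
open CategoryTheory

universe u

section HomologicalDefs

variable (R : Type u) [Ring R]

/-- The `i`-th Ext group of the `R`-modules `M` and `N`, computed in `ModuleCat R`. -/
noncomputable def extGrp (i : ℕ) (M N : ModuleCat.{u} R) : Type u :=
  ((Ext ℤ (ModuleCat.{u} R) i).obj (Opposite.op M)).obj N

/-- `Ext^i_R(M, N) = 0`. -/
def ExtVanish (i : ℕ) (M N : ModuleCat.{u} R) : Prop :=
  Subsingleton (extGrp R i M N)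

/-- `X` lies in `add M`: it is a direct summand of a finite direct sum of copies of `M`. -/
def MemAdd (M X : ModuleCat.{u} R) : Prop :=
  ∃ (k : ℕ) (f : X →ₗ[R] (Fin k → M)) (g : (Fin k → M) →ₗ[R] X),
    g.comp f = LinearMap.id

/-- `M` is an `n`-cluster tilting module for the ring `R`: `M` is a finite module and,
among the finite (= finite-dimensional) `R`-modules `X`, the members of `add M` are exactly
those with `Ext^i(M, X) = 0` for `1 ≤ i ≤ n - 1`, and also exactly those with
`Ext^i(X, M) = 0` for `1 ≤ i ≤ n - 1`. -/
def IsNClusterTilting (n : ℕ) (M : ModuleCat.{u} R) : Prop :=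
  Module.Finite R M ∧
  (∀ X : ModuleCat.{u} R, Module.Finite R X →
    (MemAdd R M X ↔ ∀ i, 1 ≤ i → i ≤ n - 1 → ExtVanish R i M X)) ∧
  (∀ X : ModuleCat.{u} R, Module.Finite R X →
    (MemAdd R M X ↔ ∀ i, 1 ≤ i → i ≤ n - 1 → ExtVanish R i X M))

/-- `X` admits a projective resolution `0 → P_m → ⋯ → P_0 → X → 0` of length at most `m`. -/
def ProjDimLE (X : ModuleCat.{u} R) (m : ℕ) : Prop :=
  ∃ (P : ℕ → ModuleCat.{u} R) (d : ∀ i, P (i + 1) ⟶ P i) (ε : P 0 ⟶ X),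
    (∀ i, i ≤ m → Module.Projective R (P i)) ∧
    (∀ i, m < i → Subsingleton (P i)) ∧
    Function.Surjective ε ∧ Function.Exact (d 0) ε ∧
    (∀ i, Function.Exact (d (i + 1)) (d i))

/-- The projective dimension of the `R`-module `X`, as an extended natural number. -/
noncomputable def projDim (X : ModuleCat.{u} R) : ℕ∞ :=
  sInf {n : ℕ∞ | ∃ m : ℕ, n = (m : ℕ∞) ∧ ProjDimLE R X m}

/-- The global dimension of the ring `R`: the supremum of the projective dimensions of all
finite (= finite-dimensional) `R`-modules. -/
noncomputable def globalDim : ℕ∞ :=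
  ⨆ (X : ModuleCat.{u} R) (_ : Module.Finite R X), projDim R X

/-- There is an exact sequence `0 → R → I_0 → ⋯ → I_{m-1}` of `R`-modules in which every
`I_j` is both projective and injective. -/
def DomDimGE (m : ℕ) : Prop :=
  ∃ (I : ℕ → ModuleCat.{u} R) (f : ModuleCat.of R R ⟶ I 0) (d : ∀ i, I i ⟶ I (i + 1)),
    (∀ i, i < m → Module.Projective R (I i) ∧ Module.Injective R (I i)) ∧
    (1 ≤ m → Function.Injective f) ∧
    (2 ≤ m → Function.Exact f (d 0)) ∧
    (∀ i, i + 3 ≤ m → Function.Exact (d i) (d (i + 1)))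

/-- The dominant dimension of the ring `R`: the supremum of the lengths `m` of exact sequences
`0 → R → I_0 → ⋯ → I_{m-1}` with all `I_j` projective and injective. -/
noncomputable def domDim : ℕ∞ :=
  sSup {n : ℕ∞ | ∃ m : ℕ, n = (m : ℕ∞) ∧ DomDimGE R m}

end HomologicalDefs

/-- A map out of an Artinian module that becomes injective after composing with a map back splits. -/
lemma LinearMap.exists_leftInverse_of_comp_injective {R E I : Type*} [Ring R]
    [AddCommGroup E] [Module R E] [AddCommGroup I] [Module R I] [IsArtinian R E]
    (s : E →ₗ[R] I) (ρ : I →ₗ[R] E) (h : Function.Injective (ρ ∘ₗ s)) :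
    ∃ r : I →ₗ[R] E, r ∘ₗ s = LinearMap.id := by
  let w := LinearEquiv.ofBijective (ρ ∘ₗ s)
    (IsArtinian.bijective_of_injective_endomorphism _ h)
  refine ⟨w.symm.toLinearMap ∘ₗ ρ, LinearMap.ext fun x ↦ ?_⟩
  exact w.symm_apply_apply x

/-- A retract of an injective module is injective. -/
lemma Module.Injective.of_split {R : Type*} [Ring R] {E I : Type u} [AddCommGroup E] [Module R E]
    [AddCommGroup I] [Module R I] [Module.Injective R I] (s : E →ₗ[R] I) (r : I →ₗ[R] E)
    (h : r ∘ₗ s = LinearMap.id) : Module.Injective R E where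
  out X Y _ _ _ _ f hf g := by
    obtain ⟨k, hk⟩ := Module.Injective.out (Q := I) f hf (s ∘ₗ g)
    refine ⟨r ∘ₗ k, fun x ↦ ?_⟩
    simpa [hk] using LinearMap.congr_fun h (g x)

lemma Module.Injective.prod {R : Type*} [Ring R] {M N : Type u} [AddCommGroup M] [Module R M]
    [AddCommGroup N] [Module R N] [Module.Injective R M] [Module.Injective R N] :
    Module.Injective R (M × N) where
  out X Y _ _ _ _ f hf g := by
    obtain ⟨k, hk⟩ := Module.Injective.out f hf (LinearMap.fst R M N ∘ₗ g)
    obtain ⟨l, hl⟩ := Module.Injective.out f hf (LinearMap.snd R M N ∘ₗ g)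
    exact ⟨k.prod l, fun x ↦ Prod.ext (hk x) (hl x)⟩

/-- Every element of a projective module is fixed by an endomorphism factoring through a finite
free module. -/
lemma Module.Projective.exists_finite_factor {R I : Type u} [Ring R] [AddCommGroup I] [Module R I]
    [Module.Projective R I] (x : I) :
    ∃ (F : Type u) (_ : AddCommGroup F) (_ : Module R F) (_ : Module.Finite R F)
      (_ : Module.Projective R F) (α : F →ₗ[R] I) (β : I →ₗ[R] F), α (β x) = x := by
  obtain ⟨s, hs⟩ := Module.projective_def'.1 ‹Module.Projective R I›
  let t : Finset I := (s x).support
  refine ⟨t →₀ R, inferInstance, inferInstance, inferInstance, inferInstance,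
    Finsupp.linearCombination R Subtype.val, Finsupp.lcomapDomain Subtype.val
      Subtype.val_injective ∘ₗ s, ?_⟩
  have hx : Finsupp.linearCombination R id (s x) = x := LinearMap.congr_fun hs x
  refine Eq.trans ?_ hx
  rw [Finsupp.linearCombination_apply, Finsupp.linearCombination_apply,
    Finsupp.sum_fintype _ _ (by simp)]
  exact Finset.sum_coe_sort t fun i ↦ s x i • i

/-- Over an Artinian ring, every element of a projective-injective module lies in a finite
projective-injective submodule. -/
lemma exists_finite_projective_injective_mem_range {R I : Type u} [Ring R] [IsArtinianRing R]
    [AddCommGroup I] [Module R I] [Module.Projective R I] [Module.Injective R I] (x : I) :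
    ∃ (E : Type u) (_ : AddCommGroup E) (_ : Module R E) (s : E →ₗ[R] I),
      Module.Finite R E ∧ Module.Projective R E ∧ Module.Injective R E ∧
        x ∈ LinearMap.range s := by
  obtain ⟨F, _, _, _, _, α, β, hx⟩ := Module.Projective.exists_finite_factor (R := R) x
  let φ : Module.End R F := β ∘ₗ α
  obtain ⟨n, hn, hn1⟩ := (φ.eventually_isCompl_ker_pow_range_pow.and
    (Filter.eventually_ge_atTop 1)).exists
  obtain ⟨k, rfl⟩ := Nat.exists_eq_add_of_le' hn1
  have hφ : ∀ (y : F) (z : F), y = (φ ^ (k + 1)) z → (φ ^ (k + 1)) y = 0 → y = 0 :=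
    fun y z hy h ↦ Submodule.disjoint_def.1 hn.disjoint y h ⟨z, hy.symm⟩
  obtain ⟨r, hr⟩ := LinearMap.exists_leftInverse_of_comp_injective
    (LinearMap.range (φ ^ (k + 1))).subtype (φ ^ (k + 1)).rangeRestrict (by
      rw [← LinearMap.ker_eq_bot, LinearMap.ker_eq_bot']
      rintro ⟨_, z, rfl⟩ h
      exact Subtype.ext (hφ _ z rfl (congrArg Subtype.val h)))
  obtain ⟨q, hq⟩ := LinearMap.exists_leftInverse_of_comp_injective
    (α ∘ₗ (LinearMap.range (φ ^ (k + 1))).subtype)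
    ((φ ^ (k + 1)).rangeRestrict ∘ₗ (φ ^ k) ∘ₗ β) (by
      rw [← LinearMap.ker_eq_bot, LinearMap.ker_eq_bot']
      rintro ⟨_, z, rfl⟩ h
      refine Subtype.ext (hφ _ z rfl (hφ _ _ rfl ?_))
      have h' := congrArg Subtype.val h
      simp only [pow_succ φ k]
      exact (pow_succ φ k ▸ h'))
  refine ⟨LinearMap.range (φ ^ (k + 1)), inferInstance, inferInstance,
    α ∘ₗ (LinearMap.range (φ ^ (k + 1))).subtype, inferInstance,
    .of_split _ r hr, .of_split _ q hq, ⟨β x, ⟨β x, ?_⟩⟩, hx⟩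
  have hfix : φ (β x) = β x := congrArg β hx
  rw [Module.End.pow_apply]
  exact Function.iterate_fixed hfix _

/-- Over an Artinian ring, every finite module has a right approximation by a finite
projective-injective module. -/
lemma exists_projective_injective_approximation {R : Type u} [Ring R] [IsArtinianRing R]
    (L : Type u) [AddCommGroup L] [Module R L] [Module.Finite R L] :
    ∃ (Q : Type u) (_ : AddCommGroup Q) (_ : Module R Q) (q : Q →ₗ[R] L),
      Module.Finite R Q ∧ Module.Projective R Q ∧ Module.Injective R Q ∧
        ∀ (I : Type u) [AddCommGroup I] [Module R I], Module.Projective R I →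
          Module.Injective R I → ∀ g : I →ₗ[R] L, ∃ h : I →ₗ[R] Q, q ∘ₗ h = g := by
  let S : Set (Submodule R L) := {N | ∃ (Q : Type u) (_ : AddCommGroup Q) (_ : Module R Q)
    (q : Q →ₗ[R] L), Module.Finite R Q ∧ Module.Projective R Q ∧ Module.Injective R Q ∧
      LinearMap.range q = N}
  have hS : S.Nonempty := ⟨⊥, PUnit, inferInstance, inferInstance, 0, inferInstance,
    inferInstance, ⟨fun X Y _ _ _ _ f hf g ↦ ⟨0, fun x ↦ rfl⟩⟩, LinearMap.range_zero⟩
  obtain ⟨N, ⟨Q, _, _, q, _, _, _, rfl⟩, hmax⟩ := set_has_maximal_iff_noetherian.2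
    (inferInstance : IsNoetherian R L) S hS
  refine ⟨Q, _, _, q, ‹_›, ‹_›, ‹_›, fun I _ _ _ _ g ↦ ?_⟩
  have hg : ∀ x, g x ∈ LinearMap.range q := fun x ↦ by
    obtain ⟨E, _, _, s, _, _, _, y, rfl⟩ :=
      exists_finite_projective_injective_mem_range (R := R) x
    by_contra hy
    refine hmax (LinearMap.range (q.coprod (g ∘ₗ s))) ⟨Q × E, _, _, _, inferInstance,
      inferInstance, .prod, rfl⟩ ?_
    rw [LinearMap.range_coprod]
    refine lt_of_le_of_ne le_sup_left fun h ↦ hy ?_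
    rw [h]
    exact le_sup_right (a := LinearMap.range q) ⟨y, rfl⟩
  obtain ⟨h, hh⟩ := Module.projective_lifting_property q.rangeRestrict
    (g.codRestrict _ hg) q.surjective_rangeRestrict
  exact ⟨h, LinearMap.ext fun x ↦ congrArg Subtype.val (LinearMap.congr_fun hh x)⟩

lemma LinearMap.exists_comp_eq_of_ker_le {R M N P : Type*} [Ring R] [AddCommGroup M] [Module R M]
    [AddCommGroup N] [Module R N] [AddCommGroup P] [Module R P] (p : M →ₗ[R] N) (v : M →ₗ[R] P)
    (hp : Function.Surjective p) (h : LinearMap.ker p ≤ LinearMap.ker v) :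
    ∃ k : N →ₗ[R] P, ∀ x, k (p x) = v x := by
  refine ⟨(LinearMap.ker p).liftQ v h ∘ₗ (p.quotKerEquivOfSurjective hp).symm.toLinearMap,
    fun x ↦ ?_⟩
  have hx : (p.quotKerEquivOfSurjective hp).symm (p x) = Submodule.Quotient.mk x :=
    (LinearEquiv.symm_apply_eq _).2 rfl
  simp [hx]

/-- If `R` has dominant dimension at least `m`, then iterated approximations `q j` by injective
modules, starting from an injective module, are surjective in degrees below `m`. -/
lemma DomDimGE.surjective_of_approximation {R : Type u} [Ring R] {m : ℕ} (hm : DomDimGE R m)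
    (L Q : ℕ → ModuleCat.{u} R) (q : ∀ j, Q j →ₗ[R] L j) (ι : ∀ j, L (j + 1) →ₗ[R] Q j)
    (hι : ∀ j, Function.Injective (ι j)) (hιq : ∀ j, Function.Exact (ι j) (q j))
    (hL : Module.Injective R (L 0)) (hQ : ∀ j, Module.Injective R (Q j))
    (happ : ∀ j (I : Type u) [AddCommGroup I] [Module R I], Module.Projective R I →
      Module.Injective R I → ∀ g : I →ₗ[R] L j, ∃ h : I →ₗ[R] Q j, q j ∘ₗ h = g)
    (j : ℕ) (hj : j + 1 ≤ m) : Function.Surjective (q j) := by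
  obtain ⟨I, f, d, hI, hf, hfd, hd⟩ := hm
  let C : ∀ i, Submodule R (I i)
    | 0 => LinearMap.range f.hom
    | i + 1 => LinearMap.range (d i).hom
  have hker : ∀ i, i + 2 ≤ m → LinearMap.ker (d i).hom = C i := fun i hi ↦ by
    cases i with
    | zero => exact LinearMap.exact_iff.1 (hfd hi)
    | succ i => exact LinearMap.exact_iff.1 (hd i (by omega))
  have hext : ∀ j i, i + j + 1 ≤ m → ∀ g : C i →ₗ[R] L j, ∃ h : I i →ₗ[R] L j,
      ∀ x : C i, h x = g x := by
    intro j
    induction j with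
    | zero => exact fun i _ g ↦ hL.out (C i).subtype (C i).subtype_injective g
    | succ j ih =>
      intro i hi g
      obtain ⟨h, hh⟩ := (hQ j).out (C i).subtype (C i).subtype_injective (ι j ∘ₗ g)
      obtain ⟨k, hk⟩ := LinearMap.exists_comp_eq_of_ker_le (d i).hom.rangeRestrict (q j ∘ₗ h)
        (d i).hom.surjective_rangeRestrict (by
          rw [LinearMap.ker_rangeRestrict, hker i (by omega)]
          intro x hx
          exact (congrArg (q j) (hh ⟨x, hx⟩)).trans ((hιq j).apply_apply_eq_zero _))
      obtain ⟨k', hk'⟩ := ih (i + 1) (by omega) k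
      obtain ⟨l, hl⟩ := happ j (I (i + 1)) (hI _ (by omega)).1 (hI _ (by omega)).2 k'
      have hmem : ∀ x, (h - l ∘ₗ (d i).hom) x ∈ LinearMap.range (ι j) := fun x ↦ by
        refine (hιq j _).1 ?_
        have h1 : q j (l ((d i).hom x)) = k' ((d i).hom x) := LinearMap.congr_fun hl _
        have h2 : k' ((d i).hom x) = q j (h x) := (hk' ⟨_, x, rfl⟩).trans (hk x)
        simp [h1, h2]
      refine ⟨(LinearEquiv.ofInjective (ι j) (hι j)).symm.toLinearMap ∘ₗ
        (h - l ∘ₗ (d i).hom).codRestrict _ hmem, fun x ↦ ?_⟩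
      refine (LinearEquiv.symm_apply_eq _).2 (Subtype.ext ?_)
      have hx : (d i).hom x = 0 := by
        rw [← LinearMap.mem_ker, hker i (by omega)]
        exact x.2
      have hhx : h x = ι j (g x) := hh x
      change h x - l ((d i).hom x) = ι j (g x)
      rw [hx, map_zero, sub_zero, hhx]
  intro y
  have hf' : Function.Injective f.hom := hf (by omega)
  obtain ⟨h, hh⟩ := hext j 0 (by omega)
    (LinearMap.toSpanSingleton R (L j) y ∘ₗ (LinearEquiv.ofInjective f.hom hf').symm.toLinearMap)
  obtain ⟨l, hl⟩ := happ j (I 0) (hI _ (by omega)).1 (hI _ (by omega)).2 h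
  refine ⟨l (f.hom (1 : R)), ?_⟩
  have h1 : (LinearEquiv.ofInjective f.hom hf').symm ⟨f.hom (1 : R), (1 : R), rfl⟩ = (1 : R) :=
    (LinearEquiv.symm_apply_eq _).2 rfl
  refine (LinearMap.congr_fun hl _).trans ((hh ⟨f.hom (1 : R), (1 : R), rfl⟩).trans ?_)
  refine (congrArg (LinearMap.toSpanSingleton R (L j) y) h1).trans ?_
  exact one_smul R y

/-- Over an Artinian ring of dominant dimension at least `m`, every finite injective module `W` has
a resolution `Q_{m-1} → ⋯ → Q_0 → W → 0` by finite projective-injective modules. -/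
lemma DomDimGE.exists_resolution {R : Type u} [Ring R] [IsArtinianRing R] {m : ℕ}
    (hm : DomDimGE R m) (W : Type u) [AddCommGroup W] [Module R W] [Module.Finite R W]
    [Module.Injective R W] :
    ∃ (Q : ℕ → ModuleCat.{u} R) (ε : Q 0 →ₗ[R] W) (d : ∀ j, Q (j + 1) →ₗ[R] Q j),
      (∀ j, Module.Finite R (Q j) ∧ Module.Projective R (Q j) ∧ Module.Injective R (Q j)) ∧
      (1 ≤ m → Function.Surjective ε) ∧ (2 ≤ m → Function.Exact (d 0) ε) ∧
      (∀ j, j + 3 ≤ m → Function.Exact (d (j + 1)) (d j)) := by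
  have happ : ∀ L : {L : ModuleCat.{u} R // Module.Finite R L}, ∃ (Q : ModuleCat.{u} R)
      (q : Q →ₗ[R] L.1), Module.Finite R Q ∧ Module.Projective R Q ∧ Module.Injective R Q ∧
        ∀ (I : Type u) [AddCommGroup I] [Module R I], Module.Projective R I →
          Module.Injective R I → ∀ g : I →ₗ[R] L.1, ∃ h : I →ₗ[R] Q, q ∘ₗ h = g := by
    rintro ⟨L, hL⟩
    obtain ⟨Q, _, _, q, hq⟩ := exists_projective_injective_approximation (R := R) L
    exact ⟨ModuleCat.of R Q, q, hq⟩
  choose Q q hfin hproj hinj happ using happ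
  let L : ℕ → {L : ModuleCat.{u} R // Module.Finite R L} := fun n ↦
    Nat.rec ⟨ModuleCat.of R W, ‹_›⟩ (fun _ L ↦ ⟨ModuleCat.of R (LinearMap.ker (q L)),
      have := hfin L; inferInstanceAs (Module.Finite R (LinearMap.ker (q L)))⟩) n
  let ι : ∀ j, (L (j + 1)).1 →ₗ[R] Q (L j) := fun j ↦ (LinearMap.ker (q (L j))).subtype
  have hι : ∀ j, Function.Injective (ι j) := fun j ↦ Subtype.val_injective
  have hιq : ∀ j, Function.Exact (ι j) (q (L j)) := fun j ↦
    LinearMap.exact_subtype_ker_map (q (L j))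
  have hsurj := hm.surjective_of_approximation (fun j ↦ (L j).1) (fun j ↦ Q (L j))
    (fun j ↦ q (L j)) ι hι hιq ‹_› (fun j ↦ hinj (L j)) (fun j ↦ happ (L j))
  refine ⟨fun j ↦ Q (L j), q (L 0), fun j ↦ ι j ∘ₗ q (L (j + 1)),
    fun j ↦ ⟨hfin _, hproj _, hinj _⟩, hsurj 0, fun h ↦ ?_, fun j h ↦ ?_⟩
  · have := hsurj 1 h
    intro y
    rw [hιq 0 y]
    exact (this.range_comp (ι 0)).symm ▸ Iff.rfl
  · have := hsurj (j + 2) h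
    intro y
    rw [LinearMap.comp_apply, map_eq_zero_iff _ (hι j), hιq (j + 1) y]
    exact (this.range_comp (ι (j + 1))).symm ▸ Iff.rfl

lemma IsScalarTower.of_compHom_algebraMap {K R M : Type*} [CommSemiring K] [Semiring R]
    [Algebra K R] [AddCommMonoid M] [Module R M] :
    letI := Module.compHom M (algebraMap K R)
    IsScalarTower K R M := by
  let _ := Module.compHom M (algebraMap K R)
  exact ⟨fun k r x ↦ by rw [Algebra.smul_def, mul_smul]; rfl⟩

section TwistedDual

open MulOpposite

variable {K R S : Type u} [Field K] [Ring R] [Algebra K R] [Ring S] [Algebra K S]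

/-- The `K`-dual of an `R`-module, as a module over `S` along `σ : S →ₐ[K] Rᵐᵒᵖ`. -/
def TwistedDual (_σ : S →ₐ[K] Rᵐᵒᵖ) (M : Type u) [AddCommGroup M] [Module K M] : Type u :=
  Module.Dual K M

namespace TwistedDual

section Basic

variable (σ : S →ₐ[K] Rᵐᵒᵖ) (M : Type u) [AddCommGroup M] [Module K M]

instance : AddCommGroup (TwistedDual σ M) := inferInstanceAs (AddCommGroup (Module.Dual K M))

instance : Module K (TwistedDual σ M) := inferInstanceAs (Module K (Module.Dual K M))

instance [FiniteDimensional K M] : FiniteDimensional K (TwistedDual σ M) :=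
  inferInstanceAs (FiniteDimensional K (Module.Dual K M))

instance : FunLike (TwistedDual σ M) M K := inferInstanceAs (FunLike (Module.Dual K M) M K)

instance : LinearMapClass (TwistedDual σ M) K M K :=
  inferInstanceAs (LinearMapClass (Module.Dual K M) K M K)

variable {σ M}

@[ext] lemma ext {φ ψ : TwistedDual σ M} (h : ∀ x, φ x = ψ x) : φ = ψ := LinearMap.ext h

@[simp] lemma add_apply (φ ψ : TwistedDual σ M) (x : M) : (φ + ψ) x = φ x + ψ x := rfl

@[simp] lemma zero_apply (x : M) : (0 : TwistedDual σ M) x = 0 := rfl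

@[simp] lemma field_smul_apply (k : K) (φ : TwistedDual σ M) (x : M) : (k • φ) x = k • φ x := rfl

variable [Module R M] [IsScalarTower K R M]

instance : SMul S (TwistedDual σ M) :=
  ⟨fun s φ ↦ (LinearMap.comp (show Module.Dual K M from φ)
    (Algebra.lsmul K K M (unop (σ s))) : Module.Dual K M)⟩

@[simp] lemma smul_apply (s : S) (φ : TwistedDual σ M) (x : M) :
    (s • φ) x = φ (unop (σ s) • x) := rfl

instance : Module S (TwistedDual σ M) where
  one_smul φ := by ext; simp
  mul_smul s t φ := by ext; simp [mul_smul]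
  smul_zero s := by ext; simp
  smul_add s φ ψ := by ext; simp
  add_smul s t φ := by ext; simp [add_smul]
  zero_smul φ := by ext; simp

instance : IsScalarTower K S (TwistedDual σ M) where
  smul_assoc k s φ := by ext; simp

end Basic

variable {M N P : Type u} [AddCommGroup M] [Module K M] [Module R M] [IsScalarTower K R M]
  [AddCommGroup N] [Module K N] [Module R N] [IsScalarTower K R N]
  [AddCommGroup P] [Module K P] [Module R P] [IsScalarTower K R P]
  {X : Type u} [AddCommGroup X] [Module K X] [Module S X] [IsScalarTower K S X]

/-- The transpose of an `R`-linear map, as an `S`-linear map of twisted duals. -/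
def map (σ : S →ₐ[K] Rᵐᵒᵖ) (f : M →ₗ[R] N) : TwistedDual σ N →ₗ[S] TwistedDual σ M where
  toFun φ := (f.restrictScalars K).dualMap φ
  map_add' _ _ := rfl
  map_smul' s φ := LinearMap.ext fun x ↦ congrArg φ (f.map_smul (unop (σ s)) x).symm

@[simp] lemma map_apply (σ : S →ₐ[K] Rᵐᵒᵖ) (f : M →ₗ[R] N) (φ : TwistedDual σ N) (x : M) :
    map σ f φ x = φ (f x) := rfl

lemma map_injective (σ : S →ₐ[K] Rᵐᵒᵖ) (f : M →ₗ[R] N) (hf : Function.Surjective f) :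
    Function.Injective (map σ f) :=
  LinearMap.dualMap_injective_of_surjective (f := f.restrictScalars K) hf

lemma map_surjective (σ : S →ₐ[K] Rᵐᵒᵖ) (f : M →ₗ[R] N) (hf : Function.Injective f) :
    Function.Surjective (map σ f) :=
  LinearMap.dualMap_surjective_of_injective (f := f.restrictScalars K) hf

lemma map_exact (σ : S →ₐ[K] Rᵐᵒᵖ) (f : M →ₗ[R] N) (g : N →ₗ[R] P) (h : Function.Exact f g) :
    Function.Exact (map σ g) (map σ f) := by
  have hfg : LinearMap.ker (g.restrictScalars K) = LinearMap.range (f.restrictScalars K) := by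
    ext x
    exact h x
  refine LinearMap.exact_iff (f := (g.restrictScalars K).dualMap)
    (g := (f.restrictScalars K).dualMap) |>.2 ?_
  rw [LinearMap.ker_dualMap_eq_dualAnnihilator_range,
    LinearMap.range_dualMap_eq_dualAnnihilator_ker, hfg]

/-- Exchange the two arguments of the bilinear form given by a map into a twisted dual. -/
def swap (σ : S →ₐ[K] Rᵐᵒᵖ) (τ : R →ₐ[K] Sᵐᵒᵖ) (h : ∀ r, unop (σ (unop (τ r))) = r)
    (g : X →ₗ[S] TwistedDual σ M) : M →ₗ[R] TwistedDual τ X where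
  toFun m := (LinearMap.flip (show X →ₗ[K] Module.Dual K M from g.restrictScalars K) m :
    Module.Dual K X)
  map_add' m n := ext fun x ↦ map_add (g x) m n
  map_smul' r m := ext fun x ↦ by
    have := congrArg (fun φ ↦ φ m) (g.map_smul (unop (τ r)) x)
    simp only [smul_apply, h] at this
    exact this.symm

@[simp] lemma swap_apply (σ : S →ₐ[K] Rᵐᵒᵖ) (τ : R →ₐ[K] Sᵐᵒᵖ)
    (h : ∀ r, unop (σ (unop (τ r))) = r) (g : X →ₗ[S] TwistedDual σ M) (m : M) (x : X) :
    swap σ τ h g m x = g x m := rfl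

/-- The evaluation map from a module to its twisted double dual. -/
def eval (σ : S →ₐ[K] Rᵐᵒᵖ) (τ : R →ₐ[K] Sᵐᵒᵖ) (h : ∀ s, unop (τ (unop (σ s))) = s) (X : Type u)
    [AddCommGroup X] [Module K X] [Module S X] [IsScalarTower K S X] :
    X →ₗ[S] TwistedDual σ (TwistedDual τ X) :=
  swap τ σ h LinearMap.id

@[simp] lemma eval_apply (σ : S →ₐ[K] Rᵐᵒᵖ) (τ : R →ₐ[K] Sᵐᵒᵖ)
    (h : ∀ s, unop (τ (unop (σ s))) = s) (x : X) (φ : TwistedDual τ X) :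
    eval σ τ h X x φ = φ x := rfl

lemma eval_bijective (σ : S →ₐ[K] Rᵐᵒᵖ) (τ : R →ₐ[K] Sᵐᵒᵖ)
    (h : ∀ s, unop (τ (unop (σ s))) = s) [FiniteDimensional K X] :
    Function.Bijective (eval σ τ h X) :=
  (Module.evalEquiv K X).bijective

/-- The twisted dual of a projective module is injective. -/
lemma injective_of_projective (σ : S →ₐ[K] Rᵐᵒᵖ) (τ : R →ₐ[K] Sᵐᵒᵖ)
    (h : ∀ r, unop (σ (unop (τ r))) = r) (h' : ∀ s, unop (τ (unop (σ s))) = s)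
    [Module.Projective R M] : Module.Injective S (TwistedDual σ M) where
  out X Y _ _ _ _ f hf g := by
    let _ : Module K X := Module.compHom X (algebraMap K S)
    let _ : Module K Y := Module.compHom Y (algebraMap K S)
    have : IsScalarTower K S X := .of_compHom_algebraMap
    have : IsScalarTower K S Y := .of_compHom_algebraMap
    obtain ⟨k, hk⟩ := Module.projective_lifting_property (map τ f) (swap σ τ h g)
      (map_surjective τ f hf)
    refine ⟨swap τ σ h' k, fun x ↦ ext fun m ↦ ?_⟩
    exact congrArg (fun φ ↦ φ x) (LinearMap.congr_fun hk m)

/-- The twisted dual of a finite injective module is projective. -/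
lemma projective_of_injective (σ : S →ₐ[K] Rᵐᵒᵖ) (τ : R →ₐ[K] Sᵐᵒᵖ)
    (h : ∀ r, unop (σ (unop (τ r))) = r) (h' : ∀ s, unop (τ (unop (σ s))) = s)
    [FiniteDimensional K S] [FiniteDimensional K M] [Module.Injective R M] :
    Module.Projective S (TwistedDual σ M) := by
  have : Module.Finite S (TwistedDual σ M) := Module.Finite.of_restrictScalars_finite K S _
  obtain ⟨n, p, hp⟩ := Module.Finite.exists_fin' S (TwistedDual σ M)
  have hi : Function.Injective (swap σ τ h p) := fun x y hxy ↦ by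
    refine (Module.evalEquiv K M).injective (LinearMap.ext fun φ ↦ ?_)
    obtain ⟨s, hs⟩ := hp φ
    have := congrArg (fun ψ ↦ ψ s) hxy
    rwa [swap_apply, swap_apply, hs] at this
  obtain ⟨r, hr⟩ := Module.Injective.out (Q := M) (swap σ τ h p) hi LinearMap.id
  let w := LinearEquiv.ofBijective _ (eval_bijective (X := Fin n → S) σ τ h')
  refine Module.Projective.of_split (w.symm.toLinearMap ∘ₗ map σ r) p ?_
  refine LinearMap.ext fun φ ↦ ext fun m ↦ ?_
  have hw : ∀ (ψ : TwistedDual σ (TwistedDual τ (Fin n → S))) (χ : TwistedDual τ (Fin n → S)),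
      χ (w.symm ψ) = ψ χ := fun ψ χ ↦
    congrArg (fun θ : TwistedDual σ (TwistedDual τ (Fin n → S)) ↦ θ χ) (w.apply_symm_apply ψ)
  exact (hw (map σ r φ) (swap σ τ h p m)).trans (congrArg φ (hr m))

end TwistedDual

open TwistedDual in
/-- A lower bound for the dominant dimension of a finite-dimensional algebra passes to an
anti-isomorphic algebra. -/
lemma DomDimGE.of_antiEquiv [FiniteDimensional K R] [FiniteDimensional K S] (σ : S →ₐ[K] Rᵐᵒᵖ)
    (τ : R →ₐ[K] Sᵐᵒᵖ) (h : ∀ r, unop (σ (unop (τ r))) = r) (h' : ∀ s, unop (τ (unop (σ s))) = s)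
    {m : ℕ} (hm : DomDimGE R m) : DomDimGE S m := by
  have : IsArtinianRing R := IsArtinianRing.of_finite K R
  have : Module.Injective R (TwistedDual τ S) := injective_of_projective τ σ h' h
  have : Module.Finite R (TwistedDual τ S) := Module.Finite.of_restrictScalars_finite K R _
  obtain ⟨Q, ε, d, hQ, hε, hdε, hd⟩ := hm.exists_resolution (TwistedDual τ S)
  let _ : ∀ j, Module K (Q j) := fun j ↦ Module.compHom (Q j) (algebraMap K R)
  have : ∀ j, IsScalarTower K R (Q j) := fun _ ↦ .of_compHom_algebraMap
  have : ∀ j, FiniteDimensional K (Q j) := fun j ↦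
    have := (hQ j).1; Module.Finite.trans R (Q j)
  have hev := eval_bijective (X := S) σ τ h'
  refine ⟨fun j ↦ ModuleCat.of S (TwistedDual σ (Q j)),
    ModuleCat.ofHom (map σ ε ∘ₗ eval σ τ h' S), fun j ↦ ModuleCat.ofHom (map σ (d j)),
    fun j _ ↦ ⟨?_, ?_⟩, fun hm ↦ ?_, fun hm ↦ ?_, fun j hj ↦ map_exact σ _ _ (hd j hj)⟩
  · have := (hQ j).2.2
    exact projective_of_injective (M := Q j) σ τ h h'
  · have := (hQ j).2.1
    exact injective_of_projective (M := Q j) σ τ h h'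
  · exact (map_injective σ ε (hε hm)).comp hev.1
  · intro φ
    refine (map_exact σ _ _ (hdε hm) φ).trans ?_
    exact (hev.2.range_comp (map σ ε)).symm ▸ Iff.rfl

end TwistedDual

lemma domDim_le_domDim {R S : Type u} [Ring R] [Ring S]
    (h : ∀ m, DomDimGE R m → DomDimGE S m) : domDim R ≤ domDim S :=
  sSup_le_sSup fun _ ⟨m, hn, hm⟩ ↦ ⟨m, hn, h m hm⟩

/-- For a finite-dimensional algebra `A` over a field `K`, the dominant
dimension of `A` equals the dominant dimension of the opposite algebra `Aᵐᵒᵖ` (right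
`A`-modules are `Aᵐᵒᵖ`-modules, and right `Aᵐᵒᵖ`-modules are `Aᵐᵒᵖᵐᵒᵖ`-modules). -/
theorem domDim_eq_domDim_op (K : Type u) [Field K] (A : Type u) [Ring A] [Algebra K A]
    [FiniteDimensional K A] :
    domDim Aᵐᵒᵖ = domDim Aᵐᵒᵖᵐᵒᵖ := by
  apply le_antisymm
  · exact domDim_le_domDim fun m ↦ DomDimGE.of_antiEquiv (K := K) (AlgHom.id K _)
      (AlgEquiv.opOp K Aᵐᵒᵖ).toAlgHom (fun _ ↦ rfl) fun _ ↦ rfl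
  · exact domDim_le_domDim fun m ↦ DomDimGE.of_antiEquiv (K := K) (AlgEquiv.opOp K Aᵐᵒᵖ).toAlgHom
      (AlgHom.id K _) (fun _ ↦ rfl) fun _ ↦ rfl
end
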